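/- Suppose Conditions 2.1, 4.1 (with parameter θ₁) and 4.3 (with parameters θ₂, θ₃) are met, and let ω ∈ (0, min{ θ₁/(2(1−θ₁)), θ₂/(2(1−θ₂)), θ₃ − 1/2 }) and c ∈ (0,1). Then for any sequence δ_n ↓ 0: (i) sup over u, u' ∈ [c/n, 1−c/n]^d with |u − u'| ≤ δ_n of | 𝔺_n(u)/g_ω(u) − 𝔺_n(u')/g_ω(u') | = o_P(1); and (ii) sup over u, u' ∈ [0,1]^d with |u − u'| ≤ δ_n of | C̄_n(u)/g̃_ω(u) − C̄_n(u')/g̃_ω(u') | = o_P(1), where g̃_ω(u) = g_ω(u) + 1{g_ω(u) = 0}. -/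

import Mathlib

open MeasureTheory Filter Set
open scoped ENNReal NNReal

noncomputable section

namespace BBV

variable {Ω : Type*} [MeasurableSpace Ω] {E : Type*} [MeasurableSpace E] {d : ℕ}

/-- The real-valued indicator function of a set. -/
def indic {α : Type*} (s : Set α) (x : α) : ℝ := s.indicator (fun _ => (1 : ℝ)) x

/-- `Z n = o_P(r n)`: convergence to zero in (outer) probability at rate `r`. -/
def oP (P : Measure Ω) (Z : ℕ → Ω → ℝ) (r : ℕ → ℝ) : Prop :=
  ∀ ε : ℝ, 0 < ε → Tendsto (fun n => P {ω | ε * r n < |Z n ω|}) atTop (nhds 0)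

/-- `Z n = o_P(1)`: convergence to zero in (outer) probability. -/
def oP1 (P : Measure Ω) (Z : ℕ → Ω → ℝ) : Prop := oP P Z fun _ => 1

/-- `Z n = O_P(1)`: boundedness in (outer) probability. -/
def bigOP (P : Measure Ω) (Z : ℕ → Ω → ℝ) : Prop :=
  ∀ ε : ℝ, 0 < ε → ∃ M : ℝ, ∀ᶠ n in atTop, P {ω | M < |Z n ω|} ≤ ENNReal.ofReal ε

/-- Strict stationarity of a two-sided sequence: all finite-dimensional distributions
are invariant under shifts. -/
def StrictlyStationary (P : Measure Ω) (X : ℤ → Ω → E) : Prop :=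
  ∀ (m : ℕ) (idx : Fin m → ℤ) (k : ℤ),
    Measure.map (fun ω (p : Fin m) => X (idx p + k) ω) P =
      Measure.map (fun ω (p : Fin m) => X (idx p) ω) P

/-- The sigma-field generated by the variables `X i`, `i ∈ S`. -/
def mixSigma (X : ℤ → Ω → E) (S : Set ℤ) : MeasurableSpace Ω :=
  ⨆ i ∈ S, MeasurableSpace.comap (X i) inferInstance

/-- The alpha-mixing coefficient of the sequence `X`. -/
def alphaMix (P : Measure Ω) (X : ℤ → Ω → E) (k : ℕ) : ℝ :=
  sSup {r : ℝ | ∃ (i : ℤ) (A B : Set Ω),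
    MeasurableSet[mixSigma X (Set.Iic i)] A ∧
    MeasurableSet[mixSigma X (Set.Ici (i + (k : ℤ)))] B ∧
    r = |(P (A ∩ B)).toReal - (P A).toReal * (P B).toReal|}

/-- Exponentially decaying alpha-mixing coefficients: `α(k) = O(a^k)` for some `a ∈ (0,1)`. -/
def ExpAlphaMixing (P : Measure Ω) (X : ℤ → Ω → E) : Prop :=
  ∃ a ∈ Set.Ioo (0 : ℝ) 1, ∃ c : ℝ, ∀ k : ℕ, 1 ≤ k → alphaMix P X k ≤ c * a ^ k

/-- Marginal c.d.f. `F_j` of the stationary sequence. -/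
def margF (P : Measure Ω) (X : ℤ → Ω → Fin d → ℝ) (j : Fin d) (x : ℝ) : ℝ :=
  (P {ω | X 0 ω j ≤ x}).toReal

/-- `U_i = (F_1(X_{i1}),…,F_d(X_{id}))`. -/
def Uv (P : Measure Ω) (X : ℤ → Ω → Fin d → ℝ) (i : ℤ) (ω : Ω) (j : Fin d) : ℝ :=
  margF P X j (X i ω j)

/-- The copula `C` of the stationary distribution, i.e. the c.d.f. of `U_0`. -/
def cop (P : Measure Ω) (X : ℤ → Ω → Fin d → ℝ) (u : Fin d → ℝ) : ℝ :=
  (P {ω | ∀ j, Uv P X 0 ω j ≤ u j}).toReal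

/-- Empirical c.d.f. `G_n` of the (unobservable) sample `U_1,…,U_n`. -/
def Gn (P : Measure Ω) (X : ℤ → Ω → Fin d → ℝ) (n : ℕ) (u : Fin d → ℝ) (ω : Ω) : ℝ :=
  (n : ℝ)⁻¹ * ∑ i ∈ Finset.Icc (1 : ℤ) (n : ℤ), indic {ω' | ∀ j, Uv P X i ω' j ≤ u j} ω

/-- The empirical process `α_n = √n (G_n − C)`. -/
def alphan (P : Measure Ω) (X : ℤ → Ω → Fin d → ℝ) (n : ℕ) (u : Fin d → ℝ) (ω : Ω) : ℝ :=
  Real.sqrt n * (Gn P X n u ω - cop P X u)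

/-- Marginal empirical c.d.f. `G_{nj}` based on `U_{1j},…,U_{nj}`. -/
def Gnj (P : Measure Ω) (X : ℤ → Ω → Fin d → ℝ) (n : ℕ) (j : Fin d) (s : ℝ) (ω : Ω) : ℝ :=
  (n : ℝ)⁻¹ * ∑ i ∈ Finset.Icc (1 : ℤ) (n : ℤ), indic {ω' | Uv P X i ω' j ≤ s} ω

/-- The marginal empirical process `α_{nj}(s) = √n (G_{nj}(s) − s)`. -/
def alphanj (P : Measure Ω) (X : ℤ → Ω → Fin d → ℝ) (n : ℕ) (j : Fin d) (s : ℝ) (ω : Ω) : ℝ :=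
  Real.sqrt n * (Gnj P X n j s ω - s)

/-- Left-continuous generalized inverse: `H⁻(s) = inf{x : H(x) ≥ s}` for `s ≠ 0`,
and `H⁻(0) = sup{x : H(x) = 0}`. -/
def genInv (H : ℝ → ℝ) (s : ℝ) : ℝ :=
  if s = 0 then sSup {x | H x = 0} else sInf {x | s ≤ H x}

/-- The marginal quantile process `β_{nj}(s) = √n (G_{nj}⁻(s) − s)`. -/
def betanj (P : Measure Ω) (X : ℤ → Ω → Fin d → ℝ) (n : ℕ) (j : Fin d) (s : ℝ) (ω : Ω) : ℝ :=
  Real.sqrt n * (genInv (fun x => Gnj P X n j x ω) s - s)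

/-- Marginal empirical c.d.f. `F_{nj}` of the observations `X_{1j},…,X_{nj}`. -/
def empCdfX (X : ℤ → Ω → Fin d → ℝ) (n : ℕ) (j : Fin d) (x : ℝ) (ω : Ω) : ℝ :=
  (n : ℝ)⁻¹ * ∑ i ∈ Finset.Icc (1 : ℤ) (n : ℤ), indic {ω' | X i ω' j ≤ x} ω

/-- Pseudo-observations `Û_{ij} = n/(n+1) · F_{nj}(X_{ij})`. -/
def pseudoObs (X : ℤ → Ω → Fin d → ℝ) (n : ℕ) (i : ℤ) (ω : Ω) (j : Fin d) : ℝ :=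
  (n : ℝ) / ((n : ℝ) + 1) * empCdfX X n j (X i ω j) ω

/-- The empirical copula `Ĉ_n`. -/
def empCop (X : ℤ → Ω → Fin d → ℝ) (n : ℕ) (u : Fin d → ℝ) (ω : Ω) : ℝ :=
  (n : ℝ)⁻¹ * ∑ i ∈ Finset.Icc (1 : ℤ) (n : ℤ), indic {ω' | ∀ j, pseudoObs X n i ω' j ≤ u j} ω

/-- The empirical copula process `ĈP_n = √n (Ĉ_n − C)`. -/
def hatCP (P : Measure Ω) (X : ℤ → Ω → Fin d → ℝ) (n : ℕ) (u : Fin d → ℝ) (ω : Ω) : ℝ :=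
  Real.sqrt n * (empCop X n u ω - cop P X u)

/-- First-order partial derivative `Ċ_j` of `C`, defined everywhere as the limsup of
difference quotients (which coincides with the partial derivative wherever it exists). -/
def Cdot (C : (Fin d → ℝ) → ℝ) (j : Fin d) (u : Fin d → ℝ) : ℝ :=
  Filter.limsup (fun h : ℝ => (C (Function.update u j (u j + h)) - C u) / h)
    (nhdsWithin 0 {(0 : ℝ)}ᶜ)

/-- The process `C̄_n(u) = α_n(u) − Σ_j Ċ_j(u) α_n(u^{(j)})`. -/
def Cbar (P : Measure Ω) (X : ℤ → Ω → Fin d → ℝ) (n : ℕ) (u : Fin d → ℝ) (ω : Ω) : ℝ :=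
  alphan P X n u ω -
    ∑ j, Cdot (cop P X) j u * alphan P X n (Function.update (fun _ => (1 : ℝ)) j (u j)) ω

/-- `C_n(u) = G_n(G_{n1}⁻(u₁),…,G_{nd}⁻(u_d))`. -/
def copGI (P : Measure Ω) (X : ℤ → Ω → Fin d → ℝ) (n : ℕ) (u : Fin d → ℝ) (ω : Ω) : ℝ :=
  Gn P X n (fun j => genInv (fun x => Gnj P X n j x ω) (u j)) ω

/-- The empirical copula process `𝔺_n = √n (C_n − C)` based on generalized inverses. -/
def CPgi (P : Measure Ω) (X : ℤ → Ω → Fin d → ℝ) (n : ℕ) (u : Fin d → ℝ) (ω : Ω) : ℝ :=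
  Real.sqrt n * (copGI P X n u ω - cop P X u)

/-- `g₁(u) = min{ min_j u_j , min_j [1 − min_{k ≠ j} u_k] }`. -/
def g1 (u : Fin d → ℝ) : ℝ :=
  min (⨅ j, u j) (⨅ j : Fin d, (1 - ⨅ k : {k : Fin d // k ≠ j}, u (k : Fin d)))

/-- The weight function `g_ω(u) = g₁(u)^ω`. -/
def gW (w : ℝ) (u : Fin d → ℝ) : ℝ := g1 u ^ w

/-- `g̃_ω(u) = g_ω(u) + 1{g_ω(u) = 0}`. -/
def gTilde (w : ℝ) (u : Fin d → ℝ) : ℝ := if gW w u = 0 then 1 else gW w u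

/-- `N(a,b) = {u ∈ [0,1]^d : a < g₁(u) ≤ b}`. -/
def NN (d : ℕ) (a b : ℝ) : Set (Fin d → ℝ) :=
  {u | (∀ j, 0 ≤ u j ∧ u j ≤ 1) ∧ a < g1 u ∧ g1 u ≤ b}

/-- `V_j = {u ∈ [0,1]^d : u_j ∈ (0,1)}`. -/
def VV (d : ℕ) (j : Fin d) : Set (Fin d → ℝ) :=
  {u | (∀ k, 0 ≤ u k ∧ u k ≤ 1) ∧ 0 < u j ∧ u j < 1}

/-- Condition 2.1: existence, continuity and growth bounds for the first and second
order partial derivatives of the copula `C`. -/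
def Condition21 (C : (Fin d → ℝ) → ℝ) : Prop :=
  (∀ j : Fin d, ∀ u ∈ VV d j,
    HasDerivAt (fun t => C (Function.update u j t)) (Cdot C j u) (u j)) ∧
  (∀ j : Fin d, ContinuousOn (Cdot C j) (VV d j)) ∧
  ∃ Cdd : Fin d → Fin d → (Fin d → ℝ) → ℝ,
    (∀ j₁ j₂ : Fin d, ∀ u ∈ VV d j₁ ∩ VV d j₂,
      HasDerivAt (fun t => Cdot C j₂ (Function.update u j₁ t)) (Cdd j₁ j₂ u) (u j₁)) ∧
    (∀ j₁ j₂ : Fin d, ContinuousOn (Cdd j₁ j₂) (VV d j₁ ∩ VV d j₂)) ∧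
    ∃ K : ℝ, 0 < K ∧ ∀ j₁ j₂ : Fin d, ∀ u ∈ VV d j₁ ∩ VV d j₂,
      |Cdd j₁ j₂ u| ≤ K * min (1 / (u j₁ * (1 - u j₁))) (1 / (u j₂ * (1 - u j₂)))

/-- The weighted modulus of continuity `M_n(δ,μ)` of the empirical process. -/
def Mn (P : Measure Ω) (X : ℤ → Ω → Fin d → ℝ) (n : ℕ) (δ μ : ℝ) (ω : Ω) : ℝ :=
  ⨆ q ∈ {q : (Fin d → ℝ) × (Fin d → ℝ) |
      q.1 ∈ Set.Icc 0 1 ∧ q.2 ∈ Set.Icc 0 1 ∧ dist q.1 q.2 ≤ δ},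
    |alphan P X n q.1 ω - alphan P X n q.2 ω| / max (dist q.1 q.2 ^ μ) ((n : ℝ) ^ (-μ))

/-- Condition 4.1 with parameter `θ₁`. -/
def Condition41 (P : Measure Ω) (X : ℤ → Ω → Fin d → ℝ) (θ₁ : ℝ) : Prop :=
  ∀ μ ∈ Set.Ioo (0 : ℝ) θ₁, ∀ δ : ℕ → ℝ, Tendsto δ atTop (nhds 0) →
    oP1 P (fun n ω => Mn P X n (δ n) μ ω)

/-- Condition 4.3 with parameters `θ₂, θ₃`. -/
def Condition43 (P : Measure Ω) (X : ℤ → Ω → Fin d → ℝ) (θ₂ θ₃ : ℝ) : Prop :=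
  ∀ w ∈ Set.Ioo (0 : ℝ) θ₂, ∀ lam ∈ Set.Ioo (0 : ℝ) θ₃, ∀ j : Fin d,
    bigOP P (fun n ω => ⨆ s ∈ Set.Ioo (0 : ℝ) 1,
      |alphanj P X n j s ω| / (s * (1 - s)) ^ w) ∧
    bigOP P (fun n ω => ⨆ s ∈ Set.Ioo ((n : ℝ) ^ (-lam)) (1 - (n : ℝ) ^ (-lam)),
      |betanj P X n j s ω| / (s * (1 - s)) ^ w)

/-- An increment of a function of `d` variables is the sum of its increments along the
coordinates, so that relations satisfied by one-coordinate increments add up. -/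
lemma exists_sum_coordinate_increments (H : (Fin d → ℝ) → ℝ) (x y : Fin d → ℝ)
    (R : Fin d → ℝ → Prop)
    (h : ∀ k z, (∀ i, z i = x i ∨ z i = y i) →
      R k (H (Function.update z k (y k)) - H (Function.update z k (x k)))) :
    ∃ r : Fin d → ℝ, (∀ k, R k (r k)) ∧ H y - H x = ∑ k, r k := by
  have key : ∀ S : Finset (Fin d), ∃ r : Fin d → ℝ, (∀ k ∈ S, R k (r k)) ∧
      H (S.piecewise y x) - H x = ∑ k ∈ S, r k := by
    intro S
    induction S using Finset.induction_on with
    | empty => exact ⟨fun _ => 0, by simp, by simp⟩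
    | insert a S ha ih =>
      obtain ⟨r, hr, hsum⟩ := ih
      have hz : ∀ i, S.piecewise y x i = x i ∨ S.piecewise y x i = y i := by
        intro i
        by_cases hi : i ∈ S <;> simp [hi]
      have h1 := h a (S.piecewise y x) hz
      have h2 : Function.update (S.piecewise y x) a (x a) = S.piecewise y x := by
        have : x a = S.piecewise y x a := by simp [ha]
        rw [this, Function.update_eq_self]
      rw [h2, ← Finset.piecewise_insert] at h1
      refine ⟨Function.update r a (H ((insert a S).piecewise y x) - H (S.piecewise y x)), ?_, ?_⟩
      · intro k hk
        by_cases hka : k = a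
        · subst hka; simpa using h1
        · simpa [hka] using hr k (Finset.mem_of_mem_insert_of_ne hk hka)
      · rw [Finset.sum_insert ha, Function.update_self]
        have : ∑ k ∈ S, Function.update r a
            (H ((insert a S).piecewise y x) - H (S.piecewise y x)) k = ∑ k ∈ S, r k := by
          refine Finset.sum_congr rfl fun k hk => ?_
          rw [Function.update_of_ne]
          rintro rfl
          exact ha hk
        rw [this, ← hsum]
        ring
  obtain ⟨r, hr, hsum⟩ := key Finset.univ
  exact ⟨r, fun k => hr k (Finset.mem_univ k), by simpa using hsum⟩

lemma abs_sub_le_sum_coordinate (H : (Fin d → ℝ) → ℝ) (x y : Fin d → ℝ) (b : Fin d → ℝ)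
    (h : ∀ k z, (∀ i, z i = x i ∨ z i = y i) →
      |H (Function.update z k (y k)) - H (Function.update z k (x k))| ≤ b k) :
    |H y - H x| ≤ ∑ k, b k := by
  obtain ⟨r, hr, hs⟩ := exists_sum_coordinate_increments H x y (fun k r => |r| ≤ b k) h
  rw [hs]
  exact (Finset.abs_sum_le_sum_abs _ _).trans (Finset.sum_le_sum fun k _ => hr k)

/-- Mean value theorem on an unordered interval. -/
lemma exists_mem_uIcc_hasDerivAt_eq {f f' : ℝ → ℝ} {a b : ℝ}
    (hc : ContinuousOn f (uIcc a b)) (hf : ∀ t ∈ Ioo (min a b) (max a b), HasDerivAt f (f' t) t)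
    (hab : a ≠ b) : ∃ t ∈ Ioo (min a b) (max a b), f b - f a = f' t * (b - a) := by
  rcases lt_or_gt_of_ne hab with h | h
  · rw [uIcc_of_lt h] at hc
    rw [min_eq_left h.le, max_eq_right h.le] at hf ⊢
    obtain ⟨t, ht, he⟩ := exists_hasDerivAt_eq_slope f f' h hc hf
    refine ⟨t, ht, ?_⟩
    have : b - a ≠ 0 := by linarith
    rw [he]; field_simp
  · rw [uIcc_of_gt h] at hc
    rw [min_eq_right h.le, max_eq_left h.le] at hf ⊢
    obtain ⟨t, ht, he⟩ := exists_hasDerivAt_eq_slope f f' h hc hf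
    refine ⟨t, ht, ?_⟩
    have h0 : a - b ≠ 0 := by linarith
    rw [he]; field_simp; ring

/-- The unit cube, as a coordinatewise predicate. -/
def inCube (u : Fin d → ℝ) : Prop := ∀ k, 0 ≤ u k ∧ u k ≤ 1

lemma inCube.update {u : Fin d → ℝ} (hu : inCube u) (j : Fin d) {s : ℝ} (h0 : 0 ≤ s)
    (h1 : s ≤ 1) : inCube (Function.update u j s) := by
  intro k
  by_cases hk : k = j
  · subst hk; simp [h0, h1]
  · simpa [hk] using hu k

lemma inCube_one : inCube (fun _ : Fin d => (1 : ℝ)) := fun _ => ⟨zero_le_one, le_rfl⟩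

lemma inCube_iff {u : Fin d → ℝ} : inCube u ↔ u ∈ Icc (0 : Fin d → ℝ) 1 := by
  constructor
  · intro h; exact ⟨fun k => (h k).1, fun k => (h k).2⟩
  · intro h k; exact ⟨h.1 k, h.2 k⟩

/-- Properties of a function `C` on `ℝ^d` and a choice `D` of its partial derivatives which are
shared by all copulas satisfying the smoothness condition. -/
structure CopulaBounds (C : (Fin d → ℝ) → ℝ) (D : Fin d → (Fin d → ℝ) → ℝ) (L : ℝ) : Prop where
  one_le : 1 ≤ L
  nonneg : ∀ u, 0 ≤ C u
  lip : ∀ u j s t, |C (Function.update u j t) - C (Function.update u j s)| ≤ |t - s|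
  zero : ∀ u j, u j = 0 → C u = 0
  one : ∀ j s, 0 ≤ s → s ≤ 1 → C (Function.update (fun _ => (1 : ℝ)) j s) = s
  D_nonneg : ∀ j u, 0 ≤ D j u
  D_le_one : ∀ j u, D j u ≤ 1
  D_zero : ∀ j k u, k ≠ j → u j = 0 → D k u = 0
  D_one : ∀ j s, 0 < s → s < 1 → D j (Function.update (fun _ => (1 : ℝ)) j s) = 1
  deriv : ∀ j, ∀ u ∈ VV d j, HasDerivAt (fun t => C (Function.update u j t)) (D j u) (u j)
  D_sub : ∀ j x y, inCube x → inCube y → 0 < x j → x j < 1 →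
    |D j x - D j y| ≤ L * dist x y / (x j * (1 - x j))

namespace CopulaBounds

variable {C : (Fin d → ℝ) → ℝ} {D : Fin d → (Fin d → ℝ) → ℝ} {L : ℝ}

lemma abs_sub_le_sum (h : CopulaBounds C D L) (x y : Fin d → ℝ) :
    |C y - C x| ≤ ∑ k, |y k - x k| :=
  abs_sub_le_sum_coordinate C x y _ fun k z _ => h.lip z k _ _

lemma abs_D_sub_le_one (h : CopulaBounds C D L) (j : Fin d) (x y : Fin d → ℝ) :
    |D j x - D j y| ≤ 1 := by
  have h1 := h.D_nonneg j x
  have h2 := h.D_nonneg j y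
  have h3 := h.D_le_one j x
  have h4 := h.D_le_one j y
  rw [abs_le]; constructor <;> linarith

lemma le_coord (h : CopulaBounds C D L) {u : Fin d → ℝ} (hu : inCube u) (j : Fin d) :
    C u ≤ u j := by
  have h1 := h.lip u j 0 (u j)
  rw [Function.update_eq_self, h.zero (Function.update u j 0) j (by simp)] at h1
  simp only [sub_zero] at h1
  rw [abs_of_nonneg (hu j).1] at h1
  exact (le_abs_self _).trans h1

lemma exists_mean_value (h : CopulaBounds C D L) {u v : Fin d → ℝ}
    (hu : ∀ k, u k ∈ Ioo (0 : ℝ) 1) (hv : ∀ k, v k ∈ Ioo (0 : ℝ) 1) :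
    ∃ x : Fin d → Fin d → ℝ, (∀ k i, x k i ∈ uIcc (u i) (v i)) ∧
      C v - C u = ∑ k, D k (x k) * (v k - u k) := by
  obtain ⟨r, hr, hs⟩ := exists_sum_coordinate_increments C u v
    (fun k r => ∃ x : Fin d → ℝ, (∀ i, x i ∈ uIcc (u i) (v i)) ∧ r = D k x * (v k - u k)) (by
      intro k z hz
      have hzu : ∀ i, z i ∈ uIcc (u i) (v i) := by
        intro i
        rcases hz i with e | e <;> rw [e] <;> simp
      have hsub : ∀ i, uIcc (u i) (v i) ⊆ Ioo (0 : ℝ) 1 := fun i =>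
        ordConnected_Ioo.uIcc_subset (hu i) (hv i)
      by_cases huv : u k = v k
      · refine ⟨z, hzu, ?_⟩
        rw [huv]; simp
      · have hmem : ∀ t ∈ uIcc (u k) (v k), Function.update z k t ∈ VV d k := by
          intro t ht
          refine ⟨fun i => ?_, ?_⟩
          · by_cases hi : i = k
            · subst hi
              have := hsub i ht
              simp [this.1.le, this.2.le]
            · have := hsub i (hzu i)
              simp [hi, this.1.le, this.2.le]
          · have := hsub k ht
            simp [this.1, this.2]
        have hder : ∀ t ∈ uIcc (u k) (v k), HasDerivAt (fun t => C (Function.update z k t))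
            (D k (Function.update z k t)) t := by
          intro t ht
          simpa using h.deriv k _ (hmem t ht)
        obtain ⟨t, ht, he⟩ := exists_mem_uIcc_hasDerivAt_eq
          (f := fun t => C (Function.update z k t))
          (fun t ht => (hder t ht).continuousAt.continuousWithinAt)
          (fun t ht => hder t (Ioo_subset_Icc_self ht)) huv
        refine ⟨Function.update z k t, fun i => ?_, he⟩
        by_cases hi : i = k
        · subst hi
          rw [Function.update_self]
          exact Ioo_subset_Icc_self ht
        · simpa [hi] using hzu i)
  choose x hx hrx using hr
  exact ⟨x, hx, by rw [hs]; exact Finset.sum_congr rfl fun k _ => hrx k⟩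

end CopulaBounds

lemma mul_rpow_le_of_le_div {a q t p L : ℝ} (ha0 : 0 ≤ a) (ha1 : a ≤ 1) (hq : 0 < q)
    (hL : 1 ≤ L) (ht : 0 ≤ t) (hp0 : 0 < p) (hp1 : p ≤ 1) (h : a ≤ L * t / q) :
    a * q ^ p ≤ L * t ^ p := by
  have h1 : a ≤ a ^ p := by
    rcases ha0.eq_or_lt with h0 | h0
    · rw [← h0, Real.zero_rpow hp0.ne']
    · simpa using Real.rpow_le_rpow_of_exponent_ge h0 ha1 hp1
  have h2 : a * q ≤ L * t := by rwa [le_div_iff₀ hq] at h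
  calc a * q ^ p ≤ a ^ p * q ^ p := by gcongr
    _ = (a * q) ^ p := (Real.mul_rpow ha0 hq.le).symm
    _ ≤ (L * t) ^ p := by gcongr
    _ = L ^ p * t ^ p := Real.mul_rpow (by linarith) ht
    _ ≤ L * t ^ p := by
      gcongr
      simpa using Real.rpow_le_rpow_of_exponent_le hL hp1

/-- Pathwise bounds on an empirical distribution function `G`, its margins `Gj` and the marginal
generalized inverses `V`. The parameters `rt`, `e`, `ℓ` play the roles of `√n`, `1/n` and
`n^{-λ}`, and `τ` is the scale at which `√n τ = τ^p`. -/
structure SampleBounds (p M rt e τ ℓ : ℝ) (C G : (Fin d → ℝ) → ℝ) (Gj V : Fin d → ℝ → ℝ) :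
    Prop where
  p_pos : 0 < p
  p_lt : p < 1 / 2
  one_le : 1 ≤ M
  rt_pos : 0 < rt
  e_pos : 0 < e
  l_pos : 0 < ℓ
  l_lt : ℓ < 1 / 3
  l_le : ℓ ≤ τ
  e_le : e ≤ τ
  t_le : τ ≤ 1
  rt_mul : rt * τ ^ (1 - p) = 1
  nonneg : ∀ u, 0 ≤ G u
  lip : ∀ u j s t, |G (Function.update u j t) - G (Function.update u j s)| ≤ |Gj j t - Gj j s|
  zero : ∀ u j, u j = 0 → G u = 0
  one : ∀ j s, G (Function.update (fun _ => (1 : ℝ)) j s) = Gj j s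
  Gj_zero : ∀ j, Gj j 0 = 0
  Gj_one : ∀ j, Gj j 1 = 1
  hold : ∀ u v, inCube u → inCube v →
    |rt * (G u - C u) - rt * (G v - C v)| ≤ M * (max (dist u v) e) ^ p
  marg : ∀ j s, 0 ≤ s → s ≤ 1 → |rt * (Gj j s - s)| ≤ M * (s * (1 - s)) ^ p
  V_mem : ∀ j s, 0 < s → s < 1 → V j s ∈ Ioo (0 : ℝ) 1
  V_mono : ∀ j s t, 0 < s → s ≤ t → t < 1 → V j s ≤ V j t
  V_le : ∀ j s, 0 < s → s < 1 → s ≤ Gj j (V j s)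
  V_jump : ∀ j s, 0 < s → s < 1 → rt * (Gj j (V j s) - s) ≤ M * e ^ p
  beta : ∀ j s, ℓ < s → s < 1 - ℓ → |rt * (V j s - s)| ≤ M * (s * (1 - s)) ^ p

namespace SampleBounds

variable {p M rt e τ ℓ L : ℝ} {C G : (Fin d → ℝ) → ℝ} {Gj V : Fin d → ℝ → ℝ}
  {D : Fin d → (Fin d → ℝ) → ℝ}

lemma t_pos (S : SampleBounds p M rt e τ ℓ C G Gj V) : 0 < τ := S.l_pos.trans_le S.l_le

lemma rt_mul_t (S : SampleBounds p M rt e τ ℓ C G Gj V) : rt * τ = τ ^ p := by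
  have h : τ = τ ^ (1 - p) * τ ^ p := by
    rw [← Real.rpow_add S.t_pos]; simp
  calc rt * τ = (rt * τ ^ (1 - p)) * τ ^ p := by rw [mul_assoc, ← h]
    _ = τ ^ p := by rw [S.rt_mul, one_mul]

lemma rt_mul_le (S : SampleBounds p M rt e τ ℓ C G Gj V) {m : ℝ} (hm0 : 0 ≤ m) (hm : m ≤ τ) :
    rt * m ≤ m ^ p := by
  rcases hm0.eq_or_lt with h0 | h0
  · rw [← h0]; simp [Real.zero_rpow S.p_pos.ne']
  have h : m = m ^ (1 - p) * m ^ p := by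
    rw [← Real.rpow_add h0]; simp
  have hlt : m ^ (1 - p) ≤ τ ^ (1 - p) :=
    Real.rpow_le_rpow hm0 hm (by linarith [S.p_lt])
  calc rt * m = (rt * m ^ (1 - p)) * m ^ p := by rw [mul_assoc, ← h]
    _ ≤ (rt * τ ^ (1 - p)) * m ^ p := by
      have := S.rt_pos
      gcongr
    _ = m ^ p := by rw [S.rt_mul, one_mul]

lemma abs_G_sub_le_sum (S : SampleBounds p M rt e τ ℓ C G Gj V) (x y : Fin d → ℝ) :
    |G y - G x| ≤ ∑ k, |Gj k (y k) - Gj k (x k)| :=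
  abs_sub_le_sum_coordinate G x y _ fun k z _ => S.lip z k _ _

lemma e_rpow_le (S : SampleBounds p M rt e τ ℓ C G Gj V) : e ^ p ≤ τ ^ p :=
  Real.rpow_le_rpow S.e_pos.le S.e_le S.p_pos.le

/-- The empirical process varies little when some coordinates are moved to `0` or `1`. -/
lemma abs_emp_sub_face_le (S : SampleBounds p M rt e τ ℓ C G Gj V) (hC : CopulaBounds C D L)
    {u y : Fin d → ℝ} (hu : inCube u) (hy : inCube y)
    (hface : ∀ k, y k = u k ∨ y k = 0 ∨ y k = 1) {m : ℝ} (hm : dist u y ≤ m) :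
    |rt * (G u - C u) - rt * (G y - C y)| ≤ (M + d * (M + 2)) * m ^ p := by
  have hM := S.one_le
  have hm0 : 0 ≤ m := dist_nonneg.trans hm
  have hd0 : (0 : ℝ) ≤ d := Nat.cast_nonneg d
  have hmp : 0 ≤ m ^ p := Real.rpow_nonneg hm0 p
  rcases le_total e m with hem | hem
  · calc _ ≤ M * (max (dist u y) e) ^ p := S.hold u y hu hy
      _ ≤ M * m ^ p := by
        have : max (dist u y) e ≤ m := max_le hm hem
        have h0 : 0 ≤ max (dist u y) e := le_max_of_le_left dist_nonneg
        have := Real.rpow_le_rpow h0 this S.p_pos.le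
        gcongr
      _ ≤ _ := by
        have : 0 ≤ (d : ℝ) * (M + 2) * m ^ p := by positivity
        linarith
  · have hrm : rt * m ≤ m ^ p := S.rt_mul_le hm0 (hem.trans S.e_le)
    have hk : ∀ k, rt * |Gj k (u k) - Gj k (y k)| + rt * |u k - y k| ≤ (M + 2) * m ^ p := by
      intro k
      have hdk : |u k - y k| ≤ m := by
        rw [← Real.dist_eq]; exact (dist_le_pi_dist u y k).trans hm
      have hrd : rt * |u k - y k| ≤ m ^ p := (mul_le_mul_of_nonneg_left hdk S.rt_pos.le).trans hrm
      rcases hface k with h | h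
      · rw [h]; simp; positivity
      · have hyk : Gj k (y k) = y k := by
          rcases h with h | h <;> rw [h]
          exacts [S.Gj_zero k, S.Gj_one k]
        have hprod : u k * (1 - u k) ≤ m := by
          have h0 := (hu k).1
          have h1 := (hu k).2
          rcases h with h | h <;> rw [h] at hdk
          · rw [sub_zero, abs_of_nonneg h0] at hdk
            nlinarith
          · rw [abs_of_nonpos (by linarith)] at hdk
            nlinarith
        have hprod0 : 0 ≤ u k * (1 - u k) := mul_nonneg (hu k).1 (by linarith [(hu k).2])
        have h1 := S.marg k (u k) (hu k).1 (hu k).2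
        have h2 : (u k * (1 - u k)) ^ p ≤ m ^ p := Real.rpow_le_rpow hprod0 hprod S.p_pos.le
        have h3 : rt * |Gj k (u k) - Gj k (y k)| ≤ M * m ^ p + m ^ p := by
          rw [hyk]
          calc rt * |Gj k (u k) - y k| ≤ rt * (|Gj k (u k) - u k| + |u k - y k|) :=
                mul_le_mul_of_nonneg_left (abs_sub_le _ _ _) S.rt_pos.le
            _ = |rt * (Gj k (u k) - u k)| + rt * |u k - y k| := by
                rw [abs_mul, abs_of_pos S.rt_pos]; ring
            _ ≤ M * m ^ p + m ^ p := by
                have := mul_le_mul_of_nonneg_left h2 (zero_le_one.trans hM)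
                linarith
        linarith
    have h1 := S.abs_G_sub_le_sum y u
    have h2 := hC.abs_sub_le_sum y u
    have h3 : |rt * (G u - C u) - rt * (G y - C y)| ≤ rt * |G u - G y| + rt * |C u - C y| := by
      have : rt * (G u - C u) - rt * (G y - C y) = rt * (G u - G y) - rt * (C u - C y) := by ring
      rw [this]
      refine (abs_sub _ _).trans ?_
      rw [abs_mul, abs_mul, abs_of_pos S.rt_pos]
    have h4 : rt * |G u - G y| + rt * |C u - C y| ≤ ∑ _k : Fin d, (M + 2) * m ^ p := by
      calc _ ≤ rt * ∑ k, |Gj k (u k) - Gj k (y k)| + rt * ∑ k, |u k - y k| := by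
            have := S.rt_pos
            gcongr
        _ = ∑ k, (rt * |Gj k (u k) - Gj k (y k)| + rt * |u k - y k|) := by
            rw [Finset.mul_sum, Finset.mul_sum, Finset.sum_add_distrib]
        _ ≤ _ := Finset.sum_le_sum fun k _ => hk k
    rw [Finset.sum_const, Finset.card_univ, Fintype.card_fin, nsmul_eq_mul] at h4
    have : 0 ≤ M * m ^ p := by positivity
    linarith

end SampleBounds

lemma dist_update_self_le {u : Fin d → ℝ} (j : Fin d) (s : ℝ) :
    dist u (Function.update u j s) ≤ |u j - s| := by
  refine (dist_pi_le_iff (abs_nonneg _)).2 fun k => ?_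
  by_cases hk : k = j
  · subst hk; simp [Real.dist_eq]
  · simp [hk]

lemma dist_update_one_le {u : Fin d → ℝ} {j : Fin d} {m : ℝ} (hm : 0 ≤ m)
    (h : ∀ k, k ≠ j → |u k - 1| ≤ m) :
    dist u (Function.update (fun _ => (1 : ℝ)) j (u j)) ≤ m := by
  refine (dist_pi_le_iff hm).2 fun k => ?_
  by_cases hk : k = j
  · subst hk; simpa using hm
  · simpa [hk, Real.dist_eq] using h k hk

lemma dist_update_update_one_le (u v : Fin d → ℝ) (j : Fin d) :
    dist (Function.update (fun _ => (1 : ℝ)) j (u j))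
      (Function.update (fun _ => (1 : ℝ)) j (v j)) ≤ dist u v := by
  refine (dist_pi_le_iff dist_nonneg).2 fun k => ?_
  by_cases hk : k = j
  · subst hk; simpa using dist_le_pi_dist u v k
  · simp [hk]

lemma ciInf_le_ciInf_add {ι : Type*} [Finite ι] [Nonempty ι] {f g : ι → ℝ} {r : ℝ}
    (h : ∀ i, f i ≤ g i + r) : ⨅ i, f i ≤ (⨅ i, g i) + r := by
  obtain ⟨i, hi⟩ := exists_eq_ciInf_of_finite (f := g)
  rw [← hi]
  exact (ciInf_le (Set.finite_range f).bddBelow i).trans (h i)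

lemma nonempty_ne (hd : 2 ≤ d) (j : Fin d) : Nonempty {k : Fin d // k ≠ j} := by
  have : Nontrivial (Fin d) := Fin.nontrivial_iff_two_le.2 hd
  obtain ⟨k, hk⟩ := exists_ne j
  exact ⟨⟨k, hk⟩⟩

lemma g1_le_add (hd : 2 ≤ d) (u v : Fin d → ℝ) : g1 u ≤ g1 v + dist u v := by
  have : Nonempty (Fin d) := ⟨⟨0, by lia⟩⟩
  have huv : ∀ k, |u k - v k| ≤ dist u v := fun k => by
    rw [← Real.dist_eq]; exact dist_le_pi_dist u v k
  unfold g1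
  rw [min_add]
  refine min_le_min ?_ ?_
  · exact ciInf_le_ciInf_add fun k => by linarith [abs_le.1 (huv k)]
  · refine ciInf_le_ciInf_add fun j => ?_
    have := nonempty_ne hd j
    have := ciInf_le_ciInf_add (f := fun k : {k : Fin d // k ≠ j} => v k)
      (g := fun k : {k : Fin d // k ≠ j} => u k) (r := dist u v)
      fun k => by linarith [abs_le.1 (huv k)]
    linarith

lemma abs_g1_sub_le (hd : 2 ≤ d) (u v : Fin d → ℝ) : |g1 u - g1 v| ≤ dist u v := by
  have h1 := g1_le_add hd u v
  have h2 := g1_le_add hd v u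
  rw [dist_comm] at h2
  rw [abs_le]; constructor <;> linarith

lemma g1_cases (hd : 2 ≤ d) (u : Fin d → ℝ) :
    (∃ j, u j = g1 u) ∨ ∃ j, ∀ k, k ≠ j → 1 - u k ≤ g1 u := by
  have : Nonempty (Fin d) := ⟨⟨0, by lia⟩⟩
  rcases min_choice (⨅ j, u j) (⨅ j : Fin d, (1 - ⨅ k : {k : Fin d // k ≠ j}, u (k : Fin d)))
    with h | h
  · left
    obtain ⟨j, hj⟩ := exists_eq_ciInf_of_finite (f := u)
    exact ⟨j, by rw [hj, g1, h]⟩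
  · right
    obtain ⟨j, hj⟩ := exists_eq_ciInf_of_finite
      (f := fun j : Fin d => (1 - ⨅ k : {k : Fin d // k ≠ j}, u (k : Fin d)))
    refine ⟨j, fun k hk => ?_⟩
    rw [g1, h, ← hj]
    have := ciInf_le (Set.finite_range fun k : {k : Fin d // k ≠ j} => u k).bddBelow ⟨k, hk⟩
    linarith

lemma le_g1 (hd : 2 ≤ d) {u : Fin d → ℝ} {a : ℝ} (h : ∀ k, a ≤ u k ∧ u k ≤ 1 - a) :
    a ≤ g1 u := by
  have : Nonempty (Fin d) := ⟨⟨0, by lia⟩⟩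
  refine le_min (le_ciInf fun k => (h k).1) (le_ciInf fun j => ?_)
  obtain ⟨k, hk⟩ := nonempty_ne hd j
  have := ciInf_le (Set.finite_range fun k : {k : Fin d // k ≠ j} => u k).bddBelow ⟨k, hk⟩
  linarith [(h k).2]

lemma g1_nonneg (hd : 2 ≤ d) {u : Fin d → ℝ} (hu : inCube u) : 0 ≤ g1 u :=
  le_g1 hd fun k => ⟨(hu k).1, by linarith [(hu k).2]⟩

lemma g1_le_one (hd : 2 ≤ d) {u : Fin d → ℝ} (hu : inCube u) : g1 u ≤ 1 := by
  have h : g1 u ≤ u ⟨0, by lia⟩ :=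
    (min_le_left _ _).trans (ciInf_le (Set.finite_range u).bddBelow _)
  exact h.trans (hu _).2

namespace SampleBounds

variable {p M rt e τ ℓ L : ℝ} {C G : (Fin d → ℝ) → ℝ} {Gj V : Fin d → ℝ → ℝ}
  {D : Fin d → (Fin d → ℝ) → ℝ}

lemma abs_D_sub_mul_le (S : SampleBounds p M rt e τ ℓ C G Gj V) (hC : CopulaBounds C D L)
    {x y : Fin d → ℝ} (hx : inCube x) (hy : inCube y) (j : Fin d) :
    |D j x - D j y| * |rt * (Gj j (x j) - x j)| ≤ M * (L * dist x y ^ p) := by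
  have hL := hC.one_le
  have hM := S.one_le
  have hd0 : 0 ≤ dist x y := dist_nonneg
  have hnn : 0 ≤ M * (L * dist x y ^ p) := by positivity
  have h01 := hx j
  have hm := S.marg j (x j) h01.1 h01.2
  rcases h01.1.eq_or_lt with h0 | h0
  · rw [← h0, S.Gj_zero]; simpa using hnn
  rcases h01.2.eq_or_lt with h1 | h1
  · rw [h1, S.Gj_one]; simpa using hnn
  have hq : 0 < x j * (1 - x j) := mul_pos h0 (by linarith)
  have h2 := mul_rpow_le_of_le_div (abs_nonneg _) (hC.abs_D_sub_le_one j x y) hq hL hd0 S.p_pos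
    (by linarith [S.p_lt]) (hC.D_sub j x y hx hy h0 h1)
  calc _ ≤ |D j x - D j y| * (M * (x j * (1 - x j)) ^ p) := by gcongr
    _ = M * (|D j x - D j y| * (x j * (1 - x j)) ^ p) := by ring
    _ ≤ _ := by gcongr

/-- Increments of the linearized empirical copula process are controlled by increments of the
empirical process. -/
lemma abs_linearized_sub_le (S : SampleBounds p M rt e τ ℓ C G Gj V) (hC : CopulaBounds C D L)
    {x y : Fin d → ℝ} (hx : inCube x) (hy : inCube y) {t r : ℝ} (hr : dist x y ≤ r)
    (hG : |rt * (G x - C x) - rt * (G y - C y)| ≤ t)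
    (hGj : ∀ j, |rt * (Gj j (x j) - x j) - rt * (Gj j (y j) - y j)| ≤ t) :
    |(rt * (G x - C x) - ∑ j, D j x * (rt * (Gj j (x j) - x j))) -
      (rt * (G y - C y) - ∑ j, D j y * (rt * (Gj j (y j) - y j)))| ≤
      t + d * (t + M * (L * r ^ p)) := by
  have hL := hC.one_le
  have hM := S.one_le
  have hk : ∀ j, |D j x * (rt * (Gj j (x j) - x j)) - D j y * (rt * (Gj j (y j) - y j))| ≤
      t + M * (L * r ^ p) := by
    intro j
    have h1 := S.abs_D_sub_mul_le hC hx hy j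
    have h2 : dist x y ^ p ≤ r ^ p := Real.rpow_le_rpow dist_nonneg hr S.p_pos.le
    have h3 : M * (L * dist x y ^ p) ≤ M * (L * r ^ p) := by gcongr
    have h4 : |D j y * (rt * (Gj j (x j) - x j) - rt * (Gj j (y j) - y j))| ≤ t := by
      rw [abs_mul, abs_of_nonneg (hC.D_nonneg j y)]
      calc _ ≤ 1 * |rt * (Gj j (x j) - x j) - rt * (Gj j (y j) - y j)| := by
            gcongr; exact hC.D_le_one j y
        _ ≤ t := by rw [one_mul]; exact hGj j
    have h5 : D j x * (rt * (Gj j (x j) - x j)) - D j y * (rt * (Gj j (y j) - y j)) =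
      (D j x - D j y) * (rt * (Gj j (x j) - x j)) +
        D j y * (rt * (Gj j (x j) - x j) - rt * (Gj j (y j) - y j)) := by ring
    rw [h5]
    refine (abs_add_le _ _).trans ?_
    rw [abs_mul (D j x - D j y)]
    linarith
  have h6 : |∑ j, (D j x * (rt * (Gj j (x j) - x j)) - D j y * (rt * (Gj j (y j) - y j)))| ≤
      d * (t + M * (L * r ^ p)) := by
    refine (Finset.abs_sum_le_sum_abs _ _).trans ?_
    refine (Finset.sum_le_sum fun j _ => hk j).trans_eq ?_
    rw [Finset.sum_const, Finset.card_univ, Fintype.card_fin, nsmul_eq_mul]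
  have h7 : (rt * (G x - C x) - ∑ j, D j x * (rt * (Gj j (x j) - x j))) -
      (rt * (G y - C y) - ∑ j, D j y * (rt * (Gj j (y j) - y j))) =
      (rt * (G x - C x) - rt * (G y - C y)) -
      ∑ j, (D j x * (rt * (Gj j (x j) - x j)) - D j y * (rt * (Gj j (y j) - y j))) := by
    rw [Finset.sum_sub_distrib]; ring
  rw [h7]
  exact (abs_sub _ _).trans (add_le_add hG h6)

lemma marg_sub_eq (S : SampleBounds p M rt e τ ℓ C G Gj V) (hC : CopulaBounds C D L)
    {x : Fin d → ℝ} (hx : inCube x) (j : Fin d) :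
    rt * (Gj j (x j) - x j) = rt * (G (Function.update (fun _ => (1 : ℝ)) j (x j)) -
      C (Function.update (fun _ => (1 : ℝ)) j (x j))) := by
  rw [S.one, hC.one j _ (hx j).1 (hx j).2]

lemma abs_linearized_sub_le_of_dist (S : SampleBounds p M rt e τ ℓ C G Gj V)
    (hC : CopulaBounds C D L) {x y : Fin d → ℝ} (hx : inCube x) (hy : inCube y) {r : ℝ}
    (hr : dist x y ≤ r) (he : e ≤ r) :
    |(rt * (G x - C x) - ∑ j, D j x * (rt * (Gj j (x j) - x j))) -
      (rt * (G y - C y) - ∑ j, D j y * (rt * (Gj j (y j) - y j)))| ≤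
      (M + d * (M + M * L)) * r ^ p := by
  have hM := S.one_le
  have key : ∀ u v : Fin d → ℝ, inCube u → inCube v → dist u v ≤ r →
      |rt * (G u - C u) - rt * (G v - C v)| ≤ M * r ^ p := by
    intro u v hu hv huv
    refine (S.hold u v hu hv).trans ?_
    have : (max (dist u v) e) ^ p ≤ r ^ p :=
      Real.rpow_le_rpow (le_max_of_le_left dist_nonneg) (max_le huv he) S.p_pos.le
    gcongr
  refine (S.abs_linearized_sub_le hC hx hy hr (key x y hx hy hr) fun j => ?_).trans_eq (by ring)
  rw [S.marg_sub_eq hC hx, S.marg_sub_eq hC hy]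
  exact key _ _ (inCube_one.update j (hx j).1 (hx j).2) (inCube_one.update j (hy j).1 (hy j).2)
    ((dist_update_update_one_le x y j).trans hr)

lemma linearized_eq_zero_of_zero (S : SampleBounds p M rt e τ ℓ C G Gj V)
    (hC : CopulaBounds C D L) {y : Fin d → ℝ} {j : Fin d} (hj : y j = 0) :
    rt * (G y - C y) - ∑ k, D k y * (rt * (Gj k (y k) - y k)) = 0 := by
  rw [S.zero y j hj, hC.zero y j hj, Finset.sum_eq_zero]
  · simp
  · intro k _
    by_cases hk : k = j
    · subst hk; rw [hj, S.Gj_zero]; simp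
    · rw [hC.D_zero j k y hk hj, zero_mul]

lemma linearized_eq_zero_of_one (S : SampleBounds p M rt e τ ℓ C G Gj V)
    (hC : CopulaBounds C D L) {j : Fin d} {s : ℝ} (hs0 : 0 ≤ s) (hs1 : s ≤ 1) {y : Fin d → ℝ}
    (hy : y = Function.update (fun _ => (1 : ℝ)) j s) :
    rt * (G y - C y) - ∑ k, D k y * (rt * (Gj k (y k) - y k)) = 0 := by
  rw [Finset.sum_eq_single j]
  · have hyj : y j = s := by rw [hy]; simp
    rw [hyj]
    nth_rewrite 1 [hy]
    rw [S.one]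
    nth_rewrite 1 [hy]
    rw [hC.one j s hs0 hs1]
    rcases hs0.eq_or_lt with h0 | h0
    · rw [← h0, S.Gj_zero]; simp
    rcases hs1.eq_or_lt with h1 | h1
    · rw [h1, S.Gj_one]; simp
    rw [hy, hC.D_one j s h0 h1]; ring
  · intro k _ hk
    have : y k = 1 := by rw [hy]; simp [hk]
    rw [this, S.Gj_one]; simp
  · simp

/-- The linearized empirical copula process is of order `g₁ ^ p`. -/
lemma abs_linearized_le (S : SampleBounds p M rt e τ ℓ C G Gj V)
    (hC : CopulaBounds C D L) (hd : 2 ≤ d) {u : Fin d → ℝ} (hu : inCube u) :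
    |rt * (G u - C u) - ∑ j, D j u * (rt * (Gj j (u j) - u j))| ≤
      ((M + d * (M + 2)) + d * ((M + d * (M + 2)) + M * L)) * g1 u ^ p := by
  have hm0 := g1_nonneg hd hu
  have key : ∀ y : Fin d → ℝ, inCube y → (∀ k, y k = u k ∨ y k = 0 ∨ y k = 1) →
      dist u y ≤ g1 u → rt * (G y - C y) - ∑ k, D k y * (rt * (Gj k (y k) - y k)) = 0 →
      |rt * (G u - C u) - ∑ j, D j u * (rt * (Gj j (u j) - u j))| ≤
      ((M + d * (M + 2)) + d * ((M + d * (M + 2)) + M * L)) * g1 u ^ p := by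
    intro y hy hf hdist h0
    have h1 := S.abs_linearized_sub_le hC hu hy hdist
      (S.abs_emp_sub_face_le hC hu hy hf hdist) (fun j => by
        rw [S.marg_sub_eq hC hu, S.marg_sub_eq hC hy]
        refine S.abs_emp_sub_face_le hC (inCube_one.update j (hu j).1 (hu j).2)
          (inCube_one.update j (hy j).1 (hy j).2) (fun k => ?_)
          ((dist_update_update_one_le u y j).trans hdist)
        by_cases hk : k = j
        · subst hk; simpa using hf k
        · simp [hk])
    rw [h0, sub_zero] at h1
    exact h1.trans_eq (by ring)
  rcases g1_cases hd u with ⟨j, hj⟩ | ⟨j, hj⟩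
  · refine key (Function.update u j 0) (hu.update j le_rfl zero_le_one) (fun k => ?_) ?_
      (S.linearized_eq_zero_of_zero hC (j := j) (by simp))
    · by_cases hk : k = j
      · subst hk; simp
      · simp [hk]
    · refine (dist_update_self_le j 0).trans ?_
      rw [sub_zero, abs_of_nonneg (hu j).1, hj]
  · refine key (Function.update (fun _ => 1) j (u j)) (inCube_one.update j (hu j).1 (hu j).2)
      (fun k => ?_) ?_ (S.linearized_eq_zero_of_one hC (hu j).1 (hu j).2 rfl)
    · by_cases hk : k = j
      · subst hk; simp
      · simp [hk]
    · refine dist_update_one_le hm0 fun k hk => ?_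
      rw [abs_of_nonpos (by linarith [(hu k).2])]
      linarith [hj k hk]

end SampleBounds

lemma mul_const_rpow_le {a m p : ℝ} (ha : 1 ≤ a) (hm : 0 ≤ m) (hp : p ≤ 1) :
    (a * m) ^ p ≤ a * m ^ p := by
  rw [Real.mul_rpow (by linarith) hm]
  gcongr
  simpa using Real.rpow_le_rpow_of_exponent_le ha hp

lemma mul_one_sub_le_two_mul {s t : ℝ} (hs0 : 0 ≤ s) (hs1 : s ≤ 1) (ht0 : 0 ≤ t) (ht1 : t ≤ 1)
    (h : |t - s| ≤ s * (1 - s) / 2) : s * (1 - s) / 2 ≤ t * (1 - t) := by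
  have h1 := abs_le.1 h
  have h2 : s * (1 - s) - t * (1 - t) = (s - t) * (1 - s - t) := by ring
  have h3 : |(s - t) * (1 - s - t)| ≤ |t - s| := by
    rw [abs_mul, abs_sub_comm s t]
    refine mul_le_of_le_one_right (abs_nonneg _) ?_
    rw [abs_le]; constructor <;> linarith
  have := le_abs_self ((s - t) * (1 - s - t))
  linarith

namespace SampleBounds

variable {p M rt e τ ℓ L : ℝ} {C G : (Fin d → ℝ) → ℝ} {Gj V : Fin d → ℝ → ℝ}
  {D : Fin d → (Fin d → ℝ) → ℝ}

/-- The marginal quantile process is either negligible, or both of the expected order and too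
small to leave the relevant neighbourhood of its argument. -/
lemma quantile_dichotomy (S : SampleBounds p M rt e τ ℓ C G Gj V) (j : Fin d) {s : ℝ}
    (hs0 : 0 < s) (hs1 : s < 1) :
    rt * |V j s - s| ≤ 4 * M ^ 2 * τ ^ p ∨
      (rt * |V j s - s| ≤ M * (s * (1 - s)) ^ p ∧ |V j s - s| ≤ s * (1 - s) / 2) := by
  have hM := S.one_le
  have hτ := S.t_pos
  have hτp : 0 < τ ^ p := Real.rpow_pos_of_pos hτ p
  have hrt := S.rt_pos
  have hp := S.p_lt
  have hl := S.l_pos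
  have hl3 := S.l_lt
  have hMM : M ≤ M ^ 2 := by nlinarith
  have hrl : rt * ℓ ≤ τ ^ p := by
    rw [← S.rt_mul_t]; exact mul_le_mul_of_nonneg_left S.l_le hrt.le
  have hbig : 2 * τ ^ p + 2 * M * τ ^ p ≤ 4 * M ^ 2 * τ ^ p := by nlinarith
  have hedge : M * (2 * ℓ * (1 - 2 * ℓ)) ^ p ≤ 2 * M * τ ^ p := by
    have h1 : (2 * ℓ * (1 - 2 * ℓ)) ^ p ≤ (2 * τ) ^ p := by
      refine Real.rpow_le_rpow (by nlinarith) ?_ S.p_pos.le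
      nlinarith [S.l_le]
    have h2 := mul_const_rpow_le (a := 2) (m := τ) (p := p) (by norm_num) hτ.le (by linarith)
    nlinarith
  have hV := S.V_mem j s hs0 hs1
  rcases le_or_gt s ℓ with h | h
  · left
    have hmono := S.V_mono j s (2 * ℓ) hs0 (by linarith) (by linarith)
    have hb := (abs_le.1 (S.beta j (2 * ℓ) (by linarith) (by linarith))).2
    have h1 : rt * V j s ≤ rt * V j (2 * ℓ) := mul_le_mul_of_nonneg_left hmono hrt.le
    have h2 : rt * s ≤ rt * ℓ := mul_le_mul_of_nonneg_left h hrt.le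
    have habs : rt * |V j s - s| = |rt * (V j s - s)| := by rw [abs_mul, abs_of_pos hrt]
    rw [habs, abs_le]
    have h3 : 0 < rt * V j s := mul_pos hrt hV.1
    have h4 : 0 < rt * s := mul_pos hrt hs0
    constructor <;> nlinarith
  rcases le_or_gt (1 - ℓ) s with h' | h'
  · left
    have hmono := S.V_mono j (1 - 2 * ℓ) s (by linarith) (by linarith) hs1
    have hb := (abs_le.1 (S.beta j (1 - 2 * ℓ) (by linarith) (by linarith))).1
    rw [show (1 - 2 * ℓ) * (1 - (1 - 2 * ℓ)) = 2 * ℓ * (1 - 2 * ℓ) by ring] at hb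
    have h1 : rt * V j (1 - 2 * ℓ) ≤ rt * V j s := mul_le_mul_of_nonneg_left hmono hrt.le
    have h2 : rt * (1 - ℓ) ≤ rt * s := mul_le_mul_of_nonneg_left h' hrt.le
    have habs : rt * |V j s - s| = |rt * (V j s - s)| := by rw [abs_mul, abs_of_pos hrt]
    rw [habs, abs_le]
    have h3 : rt * V j s < rt := by nlinarith [hV.2]
    have h4 : rt * s < rt := by nlinarith
    constructor <;> nlinarith
  · have hb := S.beta j s h h'
    rw [abs_mul, abs_of_pos hrt] at hb
    set q := s * (1 - s) with hq
    have hq0 : 0 < q := mul_pos hs0 (by linarith)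
    by_cases hsmall : |V j s - s| ≤ q / 2
    · exact Or.inr ⟨hb, hsmall⟩
    · left
      push Not at hsmall
      have h1 : rt * (q / 2) ≤ M * q ^ p := (mul_le_mul_of_nonneg_left hsmall.le hrt.le).trans hb
      have hqp : 0 < q ^ p := Real.rpow_pos_of_pos hq0 p
      have hqq : q = q ^ (1 - p) * q ^ p := by rw [← Real.rpow_add hq0]; simp
      have h2 : rt * q ^ (1 - p) ≤ 2 * M := by
        have : rt * q ^ (1 - p) * q ^ p ≤ 2 * M * q ^ p := by
          rw [mul_assoc, ← hqq]; linarith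
        exact le_of_mul_le_mul_right this hqp
      have h3 : q ^ p ≤ 2 * M * τ ^ p := by
        rcases le_total q τ with hqt | hqt
        · have := Real.rpow_le_rpow hq0.le hqt S.p_pos.le
          nlinarith
        · have h4 : 1 ≤ q / τ := by rwa [one_le_div hτ]
          have h5 : (q / τ) ^ p ≤ (q / τ) ^ (1 - p) :=
            Real.rpow_le_rpow_of_exponent_le h4 (by linarith)
          have h6 : (q / τ) ^ (1 - p) = rt * q ^ (1 - p) := by
            rw [Real.div_rpow hq0.le hτ.le, div_eq_iff (Real.rpow_pos_of_pos hτ _).ne']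
            calc q ^ (1 - p) = (rt * τ ^ (1 - p)) * q ^ (1 - p) := by rw [S.rt_mul, one_mul]
              _ = _ := by ring
          rw [Real.div_rpow hq0.le hτ.le, h6, div_le_iff₀ hτp] at h5
          nlinarith
      calc rt * |V j s - s| ≤ M * q ^ p := hb
        _ ≤ M * (2 * M * τ ^ p) := by gcongr
        _ ≤ 4 * M ^ 2 * τ ^ p := by nlinarith [sq_nonneg M]

lemma quantile_le (S : SampleBounds p M rt e τ ℓ C G Gj V) (j : Fin d) {s : ℝ}
    (hs0 : 0 < s) (hs1 : s < 1) :
    rt * |V j s - s| ≤ 4 * M ^ 2 * τ ^ p + M * (s * (1 - s)) ^ p := by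
  have h1 : 0 ≤ τ ^ p := Real.rpow_nonneg S.t_pos.le p
  have h2 : 0 ≤ (s * (1 - s)) ^ p := Real.rpow_nonneg (mul_nonneg hs0.le (by linarith)) p
  have hM := S.one_le
  rcases S.quantile_dichotomy j hs0 hs1 with h | h
  · have : 0 ≤ M * (s * (1 - s)) ^ p := by positivity
    linarith
  · have : 0 ≤ 4 * M ^ 2 * τ ^ p := by positivity
    linarith [h.1]

lemma quantile_near_le (S : SampleBounds p M rt e τ ℓ C G Gj V) (j : Fin d) {s m : ℝ}
    (hs0 : 0 < s) (hs1 : s < 1) (hsm : s * (1 - s) ≤ m) (hm : τ ≤ m) :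
    rt * |V j s - s| ≤ 5 * M ^ 2 * m ^ p ∧ |V j s - s| ≤ 5 * M ^ 2 * m := by
  have hM := S.one_le
  have hp := S.p_lt
  have hτ := S.t_pos
  have hm0 : 0 < m := hτ.trans_le hm
  have hMM : M ≤ M ^ 2 := by nlinarith
  have h0 : 0 ≤ m ^ p := Real.rpow_nonneg hm0.le p
  have h1 : rt * |V j s - s| ≤ 5 * M ^ 2 * m ^ p := by
    have h2 : (s * (1 - s)) ^ p ≤ m ^ p :=
      Real.rpow_le_rpow (mul_nonneg hs0.le (by linarith)) hsm S.p_pos.le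
    have h3 : τ ^ p ≤ m ^ p := Real.rpow_le_rpow hτ.le hm S.p_pos.le
    calc _ ≤ 4 * M ^ 2 * τ ^ p + M * (s * (1 - s)) ^ p := S.quantile_le j hs0 hs1
      _ ≤ 4 * M ^ 2 * m ^ p + M ^ 2 * m ^ p := by gcongr
      _ = _ := by ring
  refine ⟨h1, ?_⟩
  have h4 : τ ^ (1 - p) ≤ m ^ (1 - p) := Real.rpow_le_rpow hτ.le hm (by linarith)
  have h5 : m ^ p * m ^ (1 - p) = m := by rw [← Real.rpow_add hm0]; simp
  calc |V j s - s| = τ ^ (1 - p) * (rt * |V j s - s|) := by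
        rw [← mul_assoc, mul_comm _ rt, S.rt_mul, one_mul]
    _ ≤ m ^ (1 - p) * (5 * M ^ 2 * m ^ p) := by
        have := S.rt_pos
        gcongr
    _ = 5 * M ^ 2 * m := by
        rw [mul_comm, mul_assoc, h5]

lemma abs_D_sub_mul_quantile_le (S : SampleBounds p M rt e τ ℓ C G Gj V)
    (hC : CopulaBounds C D L) {u x y : Fin d → ℝ} (hu : ∀ k, u k ∈ Ioo (0 : ℝ) 1)
    (hx : ∀ i, x i ∈ uIcc (u i) (V i (u i))) (hy : inCube y) {A : ℝ} (hA : dist x y ≤ A)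
    (k : Fin d) :
    |D k x - D k y| * (rt * |V k (u k) - u k|) ≤ 4 * M ^ 2 * τ ^ p + 2 * M * L * A ^ p := by
  have hM := S.one_le
  have hL := hC.one_le
  have hA0 : 0 ≤ A := dist_nonneg.trans hA
  have hτp : 0 ≤ τ ^ p := Real.rpow_nonneg S.t_pos.le p
  have hAp : 0 ≤ A ^ p := Real.rpow_nonneg hA0 p
  have hrt := S.rt_pos
  have hxI : ∀ i, x i ∈ Ioo (0 : ℝ) 1 := fun i =>
    ordConnected_Ioo.uIcc_subset (hu i) (S.V_mem i _ (hu i).1 (hu i).2) (hx i)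
  rcases S.quantile_dichotomy k (hu k).1 (hu k).2 with h | ⟨h, h'⟩
  · calc _ ≤ 1 * (4 * M ^ 2 * τ ^ p) := by
          gcongr; exact hC.abs_D_sub_le_one k x y
      _ ≤ _ := by
          have : 0 ≤ 2 * M * L * A ^ p := by positivity
          linarith
  · have hq : 0 < u k * (1 - u k) := mul_pos (hu k).1 (by linarith [(hu k).2])
    have hxu : |x k - u k| ≤ u k * (1 - u k) / 2 := by
      refine le_trans ?_ h'
      exact Set.abs_sub_left_of_mem_uIcc (hx k)
    have hxq := mul_one_sub_le_two_mul (hu k).1.le (hu k).2.le (hxI k).1.le (hxI k).2.le hxu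
    have hD : |D k x - D k y| ≤ (2 * L) * A / (u k * (1 - u k)) := by
      calc _ ≤ L * dist x y / (x k * (1 - x k)) :=
            hC.D_sub k x y (fun i => ⟨(hxI i).1.le, (hxI i).2.le⟩) hy (hxI k).1 (hxI k).2
        _ ≤ L * A / (u k * (1 - u k) / 2) := by gcongr
        _ = _ := by field_simp
    have h2 := mul_rpow_le_of_le_div (abs_nonneg _) (hC.abs_D_sub_le_one k x y) hq
      (by linarith : 1 ≤ 2 * L) hA0 S.p_pos (by linarith [S.p_lt]) hD
    calc _ ≤ |D k x - D k y| * (M * (u k * (1 - u k)) ^ p) := by gcongr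
      _ = M * (|D k x - D k y| * (u k * (1 - u k)) ^ p) := by ring
      _ ≤ M * (2 * L * A ^ p) := by gcongr
      _ ≤ _ := by
        have : 0 ≤ 4 * M ^ 2 * τ ^ p := by positivity
        linarith

lemma abs_jump_le (S : SampleBounds p M rt e τ ℓ C G Gj V) (j : Fin d) {s : ℝ}
    (hs0 : 0 < s) (hs1 : s < 1) : |rt * (Gj j (V j s) - s)| ≤ M * e ^ p := by
  rw [abs_of_nonneg]
  · exact S.V_jump j s hs0 hs1
  · exact mul_nonneg S.rt_pos.le (by linarith [S.V_le j s hs0 hs1])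

/-- The empirical copula process based on generalized inverses is uniformly close to its
linearization. -/
lemma abs_copula_process_sub_linearized_le (S : SampleBounds p M rt e τ ℓ C G Gj V)
    (hC : CopulaBounds C D L) {u : Fin d → ℝ} (hu : ∀ k, u k ∈ Ioo (0 : ℝ) 1) :
    |rt * (G (fun k => V k (u k)) - C u) -
      (rt * (G u - C u) - ∑ j, D j u * (rt * (Gj j (u j) - u j)))| ≤
      (5 * M ^ 3 + d * (5 * M ^ 2 + 12 * M ^ 3 * L + 6 * M ^ 3)) * (τ ^ (1 - p)) ^ p := by
  have hM := S.one_le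
  have hL := hC.one_le
  have hp := S.p_lt
  have hp0 := S.p_pos
  have hτ := S.t_pos
  have hrt := S.rt_pos
  set h := τ ^ (1 - p) with hh
  have hh0 : 0 < h := Real.rpow_pos_of_pos hτ _
  have hτh : τ ≤ h := by
    simpa using Real.rpow_le_rpow_of_exponent_ge hτ S.t_le (by linarith : 1 - p ≤ 1)
  have hhp : 0 ≤ h ^ p := Real.rpow_nonneg hh0.le p
  have hτp : τ ^ p ≤ h ^ p := Real.rpow_le_rpow hτ.le hτh hp0.le
  have hτ1 : τ ^ p ≤ 1 := Real.rpow_le_one hτ.le S.t_le hp0.le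
  have hep : e ^ p ≤ h ^ p := S.e_rpow_le.trans hτp
  have hMM : M ≤ M ^ 2 := by nlinarith
  have hMM3 : M ≤ M ^ 3 := by nlinarith
  have hML : M ^ 3 ≤ M ^ 3 * L := le_mul_of_one_le_right (by positivity) hL
  set v : Fin d → ℝ := fun k => V k (u k) with hv
  have hvI : ∀ k, v k ∈ Ioo (0 : ℝ) 1 := fun k => S.V_mem k _ (hu k).1 (hu k).2
  have huc : inCube u := fun k => ⟨(hu k).1.le, (hu k).2.le⟩
  have hvc : inCube v := fun k => ⟨(hvI k).1.le, (hvI k).2.le⟩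
  have hdist : ∀ k, |v k - u k| ≤ 5 * M ^ 2 * h := by
    intro k
    have h1 := S.quantile_le k (hu k).1 (hu k).2
    have h2 : (u k * (1 - u k)) ^ p ≤ 1 := by
      refine Real.rpow_le_one (mul_nonneg (huc k).1 (by linarith [(huc k).2])) ?_ hp0.le
      nlinarith [(huc k).1, (huc k).2]
    have h3 : rt * |V k (u k) - u k| ≤ 5 * M ^ 2 := by
      have : 0 ≤ (u k * (1 - u k)) ^ p :=
        Real.rpow_nonneg (mul_nonneg (huc k).1 (by linarith [(huc k).2])) p
      calc _ ≤ 4 * M ^ 2 * 1 + M ^ 2 * 1 := h1.trans (by gcongr)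
        _ = _ := by ring
    calc |v k - u k| = (rt * h) * |v k - u k| := by rw [S.rt_mul, one_mul]
      _ = (rt * |V k (u k) - u k|) * h := by ring
      _ ≤ _ := by gcongr
  have hM1 : 1 ≤ 5 * M ^ 2 := by nlinarith
  have hkey : ∀ x y : Fin d → ℝ, inCube x → inCube y → dist x y ≤ 5 * M ^ 2 * h →
      |rt * (G x - C x) - rt * (G y - C y)| ≤ 5 * M ^ 3 * h ^ p := by
    intro x y hx hy hxy
    have h1 : max (dist x y) e ≤ 5 * M ^ 2 * h := max_le hxy (by nlinarith [S.e_le])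
    calc _ ≤ M * (max (dist x y) e) ^ p := S.hold x y hx hy
      _ ≤ M * (5 * M ^ 2 * h) ^ p := by
        have := Real.rpow_le_rpow (le_max_of_le_left dist_nonneg) h1 hp0.le
        gcongr
      _ ≤ M * (5 * M ^ 2 * h ^ p) := by
        have := mul_const_rpow_le hM1 hh0.le (by linarith : p ≤ 1)
        gcongr
      _ = _ := by ring
  have hduv : dist v u ≤ 5 * M ^ 2 * h :=
    (dist_pi_le_iff (by positivity)).2 fun k => by rw [Real.dist_eq]; exact hdist k
  obtain ⟨x, hx, hsum⟩ := hC.exists_mean_value hu hvI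
  have hsplit : rt * (G v - C u) - (rt * (G u - C u) - ∑ j, D j u * (rt * (Gj j (u j) - u j))) =
      (rt * (G v - C v) - rt * (G u - C u)) +
        ∑ k, ((D k (x k) - D k u) * (rt * (v k - u k)) +
          D k u * (rt * (v k - u k) + rt * (Gj k (u k) - u k))) := by
    have : rt * (C v - C u) = ∑ k, D k (x k) * (rt * (v k - u k)) := by
      rw [hsum, Finset.mul_sum]; exact Finset.sum_congr rfl fun k _ => by ring
    have h2 : ∑ k, ((D k (x k) - D k u) * (rt * (v k - u k)) +
          D k u * (rt * (v k - u k) + rt * (Gj k (u k) - u k))) =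
        ∑ k, D k (x k) * (rt * (v k - u k)) + ∑ j, D j u * (rt * (Gj j (u j) - u j)) := by
      rw [← Finset.sum_add_distrib]; exact Finset.sum_congr rfl fun k _ => by ring
    rw [h2, ← this]; ring
  have hterm : ∀ k, |(D k (x k) - D k u) * (rt * (v k - u k)) +
      D k u * (rt * (v k - u k) + rt * (Gj k (u k) - u k))| ≤
      (5 * M ^ 2 + 12 * M ^ 3 * L + 6 * M ^ 3) * h ^ p := by
    intro k
    have hdx : dist (x k) u ≤ 5 * M ^ 2 * h := by
      refine (dist_pi_le_iff (by positivity)).2 fun i => ?_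
      rw [Real.dist_eq]
      exact (Set.abs_sub_left_of_mem_uIcc (hx k i)).trans (hdist i)
    have h1 : |(D k (x k) - D k u) * (rt * (v k - u k))| ≤
        (5 * M ^ 2 + 12 * M ^ 3 * L) * h ^ p := by
      rw [abs_mul, abs_mul, abs_of_pos hrt]
      calc _ ≤ 4 * M ^ 2 * τ ^ p + 2 * M * L * (5 * M ^ 2 * h) ^ p :=
            S.abs_D_sub_mul_quantile_le hC hu (hx k) huc hdx k
        _ ≤ 4 * M ^ 2 * h ^ p + 2 * M * L * (5 * M ^ 2 * h ^ p) := by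
            have := mul_const_rpow_le hM1 hh0.le (by linarith : p ≤ 1)
            gcongr
        _ = (4 * M ^ 2 + 10 * (M ^ 3 * L)) * h ^ p := by ring
        _ ≤ _ := by
            gcongr ?_ * _
            nlinarith [sq_nonneg M]
    have h2 : |rt * (v k - u k) + rt * (Gj k (u k) - u k)| ≤ 6 * M ^ 3 * h ^ p := by
      have e1 : rt * (v k - u k) + rt * (Gj k (u k) - u k) =
          rt * (Gj k (v k) - u k) - (rt * (Gj k (v k) - v k) - rt * (Gj k (u k) - u k)) := by ring
      have e2 : |rt * (Gj k (v k) - u k)| ≤ M * e ^ p := S.abs_jump_le k (hu k).1 (hu k).2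
      have e3 : |rt * (Gj k (v k) - v k) - rt * (Gj k (u k) - u k)| ≤ 5 * M ^ 3 * h ^ p := by
        rw [S.marg_sub_eq hC hvc, S.marg_sub_eq hC huc]
        exact hkey _ _ (inCube_one.update k (hvc k).1 (hvc k).2)
          (inCube_one.update k (huc k).1 (huc k).2) ((dist_update_update_one_le v u k).trans hduv)
      rw [e1]
      refine (abs_sub _ _).trans ?_
      calc _ ≤ M ^ 3 * h ^ p + 5 * M ^ 3 * h ^ p := by
            refine add_le_add (e2.trans ?_) e3
            have := Real.rpow_nonneg S.e_pos.le p
            gcongr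
        _ = _ := by ring
    have h3 : |D k u * (rt * (v k - u k) + rt * (Gj k (u k) - u k))| ≤ 6 * M ^ 3 * h ^ p := by
      rw [abs_mul, abs_of_nonneg (hC.D_nonneg k u)]
      calc _ ≤ 1 * |rt * (v k - u k) + rt * (Gj k (u k) - u k)| := by
            gcongr; exact hC.D_le_one k u
        _ ≤ _ := by rwa [one_mul]
    refine (abs_add_le _ _).trans ?_
    linarith
  rw [hsplit]
  refine (abs_add_le _ _).trans ?_
  have h1 := hkey v u hvc huc hduv
  have h2 := (Finset.abs_sum_le_sum_abs _ _).trans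
    (Finset.sum_le_sum fun k (_ : k ∈ Finset.univ) => hterm k)
  rw [Finset.sum_const, Finset.card_univ, Fintype.card_fin, nsmul_eq_mul] at h2
  linarith

end SampleBounds

namespace SampleBounds

variable {p M rt e τ ℓ L : ℝ} {C G : (Fin d → ℝ) → ℝ} {Gj V : Fin d → ℝ → ℝ}
  {D : Fin d → (Fin d → ℝ) → ℝ}

lemma abs_copula_process_le_of_le (S : SampleBounds p M rt e τ ℓ C G Gj V)
    (hC : CopulaBounds C D L) (hd : 2 ≤ d) {u : Fin d → ℝ} (hu : ∀ k, u k ∈ Ioo (0 : ℝ) 1)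
    {c : ℝ} (hc0 : 0 < c) (hc1 : c < 1) (hce : c * e ≤ g1 u) (hsmall : g1 u ≤ τ) :
    |rt * (G (fun k => V k (u k)) - C u)| ≤ (2 * d + (d + 1) * (M / c)) * g1 u ^ p := by
  have hM := S.one_le
  have hrt := S.rt_pos
  have huc : inCube u := fun k => ⟨(hu k).1.le, (hu k).2.le⟩
  have hm0 := g1_nonneg hd huc
  set m := g1 u with hm
  have hmp : 0 ≤ m ^ p := Real.rpow_nonneg hm0 p
  have hrm : rt * m ≤ m ^ p := S.rt_mul_le hm0 hsmall
  set v : Fin d → ℝ := fun k => V k (u k) with hv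
  have hd2 : (2 : ℝ) ≤ d := by exact_mod_cast hd
  have hjump : ∀ k, rt * |Gj k (v k) - u k| ≤ M / c * m ^ p := by
    intro k
    have h1 := S.abs_jump_le k (hu k).1 (hu k).2
    rw [abs_mul, abs_of_pos hrt] at h1
    have h2 : c * e ^ p ≤ m ^ p := by
      have h3 := Real.rpow_le_rpow (mul_nonneg hc0.le S.e_pos.le) hce S.p_pos.le
      rw [Real.mul_rpow hc0.le S.e_pos.le] at h3
      have h4 : c ≤ c ^ p := by
        simpa using Real.rpow_le_rpow_of_exponent_ge hc0 hc1.le (by linarith [S.p_lt] : p ≤ 1)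
      exact (mul_le_mul_of_nonneg_right h4 (Real.rpow_nonneg S.e_pos.le p)).trans h3
    refine h1.trans ?_
    rw [div_mul_eq_mul_div, le_div_iff₀ hc0]
    nlinarith
  have hMc : 0 ≤ M / c := by positivity
  have hMcm : 0 ≤ M / c * m ^ p := by positivity
  rcases g1_cases hd u with ⟨j, hj⟩ | ⟨j, hj⟩
  · rw [← hm] at hj
    have hG : G v ≤ Gj j (v j) := by
      have h1 := S.lip v j 0 (v j)
      rw [Function.update_eq_self, S.zero (Function.update v j 0) j (by simp), S.Gj_zero,
        sub_zero, sub_zero, abs_of_nonneg (S.nonneg v), ← S.one, abs_of_nonneg (S.nonneg _),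
        S.one] at h1
      exact h1
    have hG0 := S.nonneg v
    have hC0 := hC.nonneg u
    have hCm : C u ≤ m := hj ▸ hC.le_coord huc j
    have h1 : rt * Gj j (v j) ≤ (1 + M / c) * m ^ p := by
      have h2 : rt * (Gj j (v j) - u j) ≤ M / c * m ^ p :=
        (mul_le_mul_of_nonneg_left (le_abs_self _) hrt.le).trans (hjump j)
      rw [hj] at h2
      linarith
    have h2 : rt * G v ≤ rt * Gj j (v j) := mul_le_mul_of_nonneg_left hG hrt.le
    have h3 : rt * C u ≤ rt * m := mul_le_mul_of_nonneg_left hCm hrt.le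
    have h4 : 0 ≤ rt * G v := mul_nonneg hrt.le hG0
    have h5 : 0 ≤ rt * C u := mul_nonneg hrt.le hC0
    have h6 : |rt * (G v - C u)| ≤ (1 + M / c) * m ^ p := by
      rw [mul_sub, abs_le]; constructor <;> linarith
    refine h6.trans ?_
    gcongr ?_ * _
    nlinarith
  · rw [← hm] at hj
    have hGy : rt * |G v - Gj j (v j)| ≤ d * ((1 + M / c) * m ^ p) := by
      have h1 := S.abs_G_sub_le_sum (Function.update (fun _ => (1 : ℝ)) j (v j)) v
      rw [S.one] at h1
      calc rt * |G v - Gj j (v j)| ≤ rt * ∑ k, |Gj k (v k) -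
            Gj k (Function.update (fun _ => (1 : ℝ)) j (v j) k)| := by gcongr
        _ = ∑ k, rt * |Gj k (v k) - Gj k (Function.update (fun _ => (1 : ℝ)) j (v j) k)| :=
            Finset.mul_sum _ _ _
        _ ≤ ∑ _k : Fin d, (1 + M / c) * m ^ p := by
            refine Finset.sum_le_sum fun k _ => ?_
            by_cases hk : k = j
            · subst hk
              simp only [Function.update_self, sub_self, abs_zero, mul_zero]
              positivity
            · rw [Function.update_of_ne hk, S.Gj_one]
              have h2 : |Gj k (v k) - 1| ≤ |Gj k (v k) - u k| + m := by
                refine (abs_sub_le _ (u k) _).trans ?_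
                gcongr
                rw [abs_sub_comm, abs_of_nonneg (by linarith [(hu k).2])]
                exact hj k hk
              have h3 := mul_le_mul_of_nonneg_left h2 hrt.le
              have h4 := hjump k
              linarith
        _ = _ := by rw [Finset.sum_const, Finset.card_univ, Fintype.card_fin, nsmul_eq_mul]
    have hCy : rt * |C u - u j| ≤ d * m ^ p := by
      have h1 := hC.abs_sub_le_sum (Function.update (fun _ => (1 : ℝ)) j (u j)) u
      rw [hC.one j _ (huc j).1 (huc j).2] at h1
      calc rt * |C u - u j| ≤ rt * ∑ k, |u k -
            Function.update (fun _ => (1 : ℝ)) j (u j) k| := by gcongr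
        _ ≤ rt * ∑ _k : Fin d, m := by
            gcongr with k
            by_cases hk : k = j
            · subst hk; simpa using hm0
            · rw [Function.update_of_ne hk, abs_sub_comm, abs_of_nonneg (by linarith [(hu k).2])]
              exact hj k hk
        _ = d * (rt * m) := by
            rw [Finset.sum_const, Finset.card_univ, Fintype.card_fin, nsmul_eq_mul]; ring
        _ ≤ _ := by gcongr
    have h1 : |G v - C u| ≤ |G v - Gj j (v j)| + |Gj j (v j) - u j| + |C u - u j| := by
      have := abs_sub_le (G v) (Gj j (v j)) (C u)
      have h2 := abs_sub_le (Gj j (v j)) (u j) (C u)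
      rw [abs_sub_comm (u j)] at h2
      linarith
    have h2 := mul_le_mul_of_nonneg_left h1 hrt.le
    rw [abs_mul, abs_of_pos hrt]
    have h3 := hjump j
    linarith

lemma abs_copula_process_le_of_ge (S : SampleBounds p M rt e τ ℓ C G Gj V)
    (hC : CopulaBounds C D L) (hd : 2 ≤ d) {u : Fin d → ℝ} (hu : ∀ k, u k ∈ Ioo (0 : ℝ) 1)
    (hlarge : τ ≤ g1 u) :
    |rt * (G (fun k => V k (u k)) - C u)| ≤
      ((M + d * (M + 2)) * (6 * M ^ 2) + M + d * (5 * M ^ 2 + 12 * M ^ 3 * L)) * g1 u ^ p := by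
  have hM := S.one_le
  have hL := hC.one_le
  have hrt := S.rt_pos
  have hp := S.p_lt
  have huc : inCube u := fun k => ⟨(hu k).1.le, (hu k).2.le⟩
  have hm0 := g1_nonneg hd huc
  set m := g1 u with hm
  have hmp : 0 ≤ m ^ p := Real.rpow_nonneg hm0 p
  have hτp : τ ^ p ≤ m ^ p := Real.rpow_le_rpow S.t_pos.le hlarge S.p_pos.le
  have hM2 : 1 ≤ M ^ 2 := one_le_pow₀ hM
  have hM6 : 1 ≤ 6 * M ^ 2 := by linarith
  have hF0 : 0 ≤ M + d * (M + 2) := by positivity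
  have hT0 : 0 ≤ 12 * M ^ 3 * L := by positivity
  have hpow : (6 * M ^ 2 * m) ^ p ≤ 6 * M ^ 2 * m ^ p :=
    mul_const_rpow_le hM6 hm0 (by linarith)
  set v : Fin d → ℝ := fun k => V k (u k) with hv
  have hvI : ∀ k, v k ∈ Ioo (0 : ℝ) 1 := fun k => S.V_mem k _ (hu k).1 (hu k).2
  have hvc : inCube v := fun k => ⟨(hvI k).1.le, (hvI k).2.le⟩
  obtain ⟨x, hx, hsum⟩ := hC.exists_mean_value hu hvI
  have hxI : ∀ k i, x k i ∈ Ioo (0 : ℝ) 1 := fun k i =>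
    ordConnected_Ioo.uIcc_subset (hu i) (hvI i) (hx k i)
  have hxc : ∀ k, inCube (x k) := fun k i => ⟨(hxI k i).1.le, (hxI k i).2.le⟩
  have hnear : ∀ k, u k * (1 - u k) ≤ m →
      rt * |v k - u k| ≤ (5 * M ^ 2 + 12 * M ^ 3 * L) * m ^ p ∧ |v k - u k| ≤ 5 * M ^ 2 * m := by
    intro k hk
    obtain ⟨h1, h2⟩ := S.quantile_near_le k (hu k).1 (hu k).2 hk hlarge
    refine ⟨h1.trans ?_, h2⟩
    gcongr
    linarith
  have hfar : ∀ k y, inCube y → dist (x k) y ≤ 6 * M ^ 2 * m →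
      |(D k (x k) - D k y) * (rt * (v k - u k))| ≤ (5 * M ^ 2 + 12 * M ^ 3 * L) * m ^ p := by
    intro k y hy hxy
    rw [abs_mul, abs_mul, abs_of_pos hrt]
    calc _ ≤ 4 * M ^ 2 * τ ^ p + 2 * M * L * (6 * M ^ 2 * m) ^ p :=
          S.abs_D_sub_mul_quantile_le hC hu (hx k) hy hxy k
      _ ≤ 4 * M ^ 2 * m ^ p + 2 * M * L * (6 * M ^ 2 * m ^ p) := by gcongr
      _ = (4 * M ^ 2 + 12 * M ^ 3 * L) * m ^ p := by ring
      _ ≤ _ := by gcongr; norm_num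
  have hsum' : rt * (C v - C u) = ∑ k, D k (x k) * (rt * (v k - u k)) := by
    rw [hsum, Finset.mul_sum]; exact Finset.sum_congr rfl fun k _ => by ring
  have hcard : ∀ f : Fin d → ℝ, (∀ k, |f k| ≤ (5 * M ^ 2 + 12 * M ^ 3 * L) * m ^ p) →
      |∑ k, f k| ≤ d * ((5 * M ^ 2 + 12 * M ^ 3 * L) * m ^ p) := by
    intro f hf
    have := (Finset.abs_sum_le_sum_abs f Finset.univ).trans (Finset.sum_le_sum fun k _ => hf k)
    rwa [Finset.sum_const, Finset.card_univ, Fintype.card_fin, nsmul_eq_mul] at this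
  have hface : ∀ y, inCube y → (∀ k, y k = v k ∨ y k = 0 ∨ y k = 1) → dist v y ≤ 6 * M ^ 2 * m →
      |rt * (G v - C v) - rt * (G y - C y)| ≤ (M + d * (M + 2)) * (6 * M ^ 2) * m ^ p := by
    intro y hy hyv hdist
    refine (S.abs_emp_sub_face_le hC hvc hy hyv hdist).trans ?_
    rw [mul_assoc (M + d * (M + 2))]
    exact mul_le_mul_of_nonneg_left hpow hF0
  rcases g1_cases hd u with ⟨j, hj⟩ | ⟨j, hj⟩
  · rw [← hm] at hj
    have hpj : u j * (1 - u j) ≤ m := by rw [hj]; nlinarith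
    have hvj := (hnear j hpj).2
    have hzero : ∀ y : Fin d → ℝ, y j ∈ uIcc (u j) (v j) →
        dist y (Function.update y j 0) ≤ 6 * M ^ 2 * m := by
      intro y hy
      refine (dist_update_self_le j 0).trans ?_
      have h1 := Set.abs_sub_left_of_mem_uIcc hy
      rw [hj] at h1 hvj
      have h2 := abs_sub_le (y j) m 0
      rw [sub_zero m, abs_of_nonneg hm0] at h2
      nlinarith
    have h1 := hface (Function.update v j 0) (hvc.update j le_rfl zero_le_one)
      (fun k => by by_cases hk : k = j <;> simp [hk])
      (hzero v right_mem_uIcc)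
    rw [S.zero (Function.update v j 0) j (by simp), hC.zero (Function.update v j 0) j (by simp),
      sub_zero, mul_zero, sub_zero] at h1
    have h2 := hcard (fun k => D k (x k) * (rt * (v k - u k))) (by
      intro k
      by_cases hk : k = j
      · subst hk
        rw [abs_mul, abs_of_nonneg (hC.D_nonneg _ _)]
        refine (mul_le_of_le_one_left (abs_nonneg _) (hC.D_le_one _ _)).trans ?_
        rw [abs_mul, abs_of_pos hrt]
        exact (hnear k hpj).1
      · have h3 := hfar k (Function.update (x k) j 0) ((hxc k).update j le_rfl zero_le_one)
          (hzero _ (hx k j))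
        rwa [hC.D_zero j k (Function.update (x k) j 0) hk (by simp), sub_zero] at h3)
    have h3 : rt * (G v - C u) =
        rt * (G v - C v) + ∑ k, D k (x k) * (rt * (v k - u k)) := by rw [← hsum']; ring
    rw [h3]
    refine (abs_add_le _ _).trans ?_
    have : 0 ≤ M * m ^ p := by positivity
    linarith
  · rw [← hm] at hj
    have hpk : ∀ k, k ≠ j → u k * (1 - u k) ≤ m := fun k hk => by
      nlinarith [hj k hk, (hu k).1, (hu k).2]
    have hone : ∀ y : Fin d → ℝ, (∀ k, y k ∈ uIcc (u k) (v k)) →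
        dist y (Function.update (fun _ => (1 : ℝ)) j (y j)) ≤ 6 * M ^ 2 * m := by
      intro y hy
      refine dist_update_one_le (by positivity) fun k hk => ?_
      have h1 := Set.abs_sub_left_of_mem_uIcc (hy k)
      have h2 := (hnear k (hpk k hk)).2
      have h3 := abs_sub_le (y k) (u k) 1
      have h4 : |u k - 1| ≤ m := by
        rw [abs_sub_comm, abs_of_nonneg (by linarith [(hu k).2])]
        exact hj k hk
      nlinarith
    have h1 := hface (Function.update (fun _ => (1 : ℝ)) j (v j))
      (inCube_one.update j (hvc j).1 (hvc j).2)
      (fun k => by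
        by_cases hk : k = j
        · subst hk; simp
        · simp [hk])
      (hone v fun k => right_mem_uIcc)
    rw [← S.marg_sub_eq hC hvc] at h1
    have h2 := hcard (fun k => (D k (x k) - if k = j then 1 else 0) * (rt * (v k - u k))) (by
      intro k
      by_cases hk : k = j
      · subst hk
        have h3 := hfar k (Function.update (fun _ => (1 : ℝ)) k (x k k))
          (inCube_one.update k (hxc k k).1 (hxc k k).2) (hone (x k) (hx k))
        rw [hC.D_one k _ (hxI k k).1 (hxI k k).2] at h3
        simpa using h3
      · rw [if_neg hk, sub_zero, abs_mul, abs_of_nonneg (hC.D_nonneg _ _)]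
        refine (mul_le_of_le_one_left (abs_nonneg _) (hC.D_le_one _ _)).trans ?_
        rw [abs_mul, abs_of_pos hrt]
        exact (hnear k (hpk k hk)).1)
    have hjump : |rt * (Gj j (v j) - u j)| ≤ M * m ^ p := by
      refine (S.abs_jump_le j (hu j).1 (hu j).2).trans ?_
      have := S.e_rpow_le.trans hτp
      gcongr
    have h3 : ∑ k, (D k (x k) - if k = j then 1 else 0) * (rt * (v k - u k)) =
        rt * (C v - C u) - rt * (v j - u j) := by
      rw [hsum']
      simp only [sub_mul, Finset.sum_sub_distrib, ite_mul, one_mul, zero_mul,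
        Finset.sum_ite_eq', Finset.mem_univ, if_true]
    have h4 : rt * (G v - C u) = (rt * (G v - C v) - rt * (Gj j (v j) - v j)) +
        rt * (Gj j (v j) - u j) +
        ∑ k, (D k (x k) - if k = j then 1 else 0) * (rt * (v k - u k)) := by rw [h3]; ring
    rw [h4]
    refine (abs_add_three _ _ _).trans ?_
    linarith

/-- The empirical copula process based on generalized inverses is of order `g₁^p`. -/
lemma abs_copula_process_le (S : SampleBounds p M rt e τ ℓ C G Gj V)
    (hC : CopulaBounds C D L) (hd : 2 ≤ d) {u : Fin d → ℝ} (hu : ∀ k, u k ∈ Ioo (0 : ℝ) 1)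
    {c : ℝ} (hc0 : 0 < c) (hc1 : c < 1) (hce : c * e ≤ g1 u) :
    |rt * (G (fun k => V k (u k)) - C u)| ≤ ((2 * d + (d + 1) * (M / c)) +
      ((M + d * (M + 2)) * (6 * M ^ 2) + M + d * (5 * M ^ 2 + 12 * M ^ 3 * L))) * g1 u ^ p := by
  have hM := S.one_le
  have hL := hC.one_le
  have hmp : 0 ≤ g1 u ^ p :=
    Real.rpow_nonneg (g1_nonneg hd fun k => ⟨(hu k).1.le, (hu k).2.le⟩) p
  rw [add_mul]
  rcases le_total (g1 u) τ with h | h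
  · refine (S.abs_copula_process_le_of_le hC hd hu hc0 hc1 hce h).trans ?_
    exact le_add_of_nonneg_right (by positivity)
  · refine (S.abs_copula_process_le_of_ge hC hd hu h).trans ?_
    exact le_add_of_nonneg_left (by positivity)

end SampleBounds

lemma gTilde_of_g1_pos {w : ℝ} {u : Fin d → ℝ} (h : 0 < g1 u) : gTilde w u = g1 u ^ w := by
  rw [gTilde, if_neg]
  · rfl
  · exact (Real.rpow_pos_of_pos h w).ne'

lemma abs_rpow_sub_rpow_le {w x y : ℝ} (hw0 : 0 < w) (hw1 : w ≤ 1) (hx : 0 ≤ x) (hy : 0 ≤ y) :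
    |x ^ w - y ^ w| ≤ |x - y| ^ w := by
  have key : ∀ a b : ℝ, 0 ≤ a → 0 ≤ b → a ^ w - b ^ w ≤ |a - b| ^ w := by
    intro a b ha hb
    have h1 : a ^ w ≤ (|a - b| + b) ^ w :=
      Real.rpow_le_rpow ha (by linarith [le_abs_self (a - b)]) hw0.le
    have h2 := Real.rpow_add_le_add_rpow (abs_nonneg (a - b)) hb hw0.le hw1
    linarith
  have h1 := key x y hx hy
  have h2 := key y x hy hx
  rw [abs_sub_comm] at h2
  rw [abs_le]; constructor <;> linarith

lemma abs_div_gTilde_le {p w B f : ℝ} {u : Fin d → ℝ} (hw : 0 < w) (hwp : w < p)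
    (hg0 : 0 ≤ g1 u) (hf : |f| ≤ B * g1 u ^ p) : |f / gTilde w u| ≤ B * g1 u ^ (p - w) := by
  rcases hg0.eq_or_lt with h | h
  · rw [← h, Real.zero_rpow (by linarith), mul_zero] at hf
    rw [← h, Real.zero_rpow (by linarith), mul_zero, abs_nonpos_iff.1 hf]
    simp
  · have hw' := Real.rpow_pos_of_pos h w
    rw [gTilde_of_g1_pos h, abs_div, abs_of_pos hw', Real.rpow_sub h, div_le_iff₀ hw']
    field_simp
    exact hf

/-- Dividing by a power of smaller order than `p` preserves moduli of continuity. -/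
lemma abs_div_gTilde_sub_le {p w B η f f' : ℝ} {u u' : Fin d → ℝ} (hw : 0 < w) (hwp : w < p)
    (hp : p ≤ 1) (hB : 0 ≤ B) (hη0 : 0 < η) (hη1 : η ≤ 1) (hg0 : 0 ≤ g1 u)
    (hg0' : 0 ≤ g1 u') (hg1' : g1 u' ≤ 1) (hg : |g1 u - g1 u'| ≤ η)
    (hf : |f| ≤ B * g1 u ^ p) (hf' : |f'| ≤ B * g1 u' ^ p) (hff : |f - f'| ≤ B * η) :
    |f / gTilde w u - f' / gTilde w u'| ≤
      B * (2 * (2 * η ^ (1 / 2 : ℝ)) ^ (p - w) + (η ^ (1 - w / 2) + η ^ (w / 2))) := by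
  set r := η ^ (1 / 2 : ℝ) with hr
  have hr0 : 0 < r := Real.rpow_pos_of_pos hη0 _
  have hηr : η ≤ r := by
    have := Real.rpow_le_rpow_of_exponent_ge hη0 hη1 (by norm_num : (1 / 2 : ℝ) ≤ 1)
    rwa [Real.rpow_one] at this
  have h1 := abs_div_gTilde_le hw hwp hg0 hf
  have h2 := abs_div_gTilde_le hw hwp hg0' hf'
  have hA : 0 ≤ (2 * r) ^ (p - w) := Real.rpow_nonneg (by positivity) _
  have hB1 : 0 ≤ η ^ (1 - w / 2) := Real.rpow_nonneg hη0.le _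
  have hB2 : 0 ≤ η ^ (w / 2) := Real.rpow_nonneg hη0.le _
  have hgg := abs_le.1 hg
  by_cases hsmall : g1 u ≤ r ∨ g1 u' ≤ r
  · have hu : g1 u ≤ 2 * r := by rcases hsmall with h | h <;> linarith
    have hu' : g1 u' ≤ 2 * r := by rcases hsmall with h | h <;> linarith
    have h3 : g1 u ^ (p - w) ≤ (2 * r) ^ (p - w) := Real.rpow_le_rpow hg0 hu (by linarith)
    have h4 : g1 u' ^ (p - w) ≤ (2 * r) ^ (p - w) := Real.rpow_le_rpow hg0' hu' (by linarith)
    have h5 := mul_le_mul_of_nonneg_left h3 hB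
    have h6 := mul_le_mul_of_nonneg_left h4 hB
    refine (abs_sub _ _).trans ?_
    have : 0 ≤ B * (η ^ (1 - w / 2) + η ^ (w / 2)) := by positivity
    linarith
  · push Not at hsmall
    obtain ⟨hu, hu'⟩ := hsmall
    have hp0 : 0 < g1 u := hr0.trans hu
    have hp0' : 0 < g1 u' := hr0.trans hu'
    have hrw : r ^ w = η ^ (w / 2) := by
      rw [hr, ← Real.rpow_mul hη0.le]; congr 1; ring
    have hrw0 : 0 < r ^ w := Real.rpow_pos_of_pos hr0 w
    have hgw : r ^ w ≤ g1 u ^ w := Real.rpow_le_rpow hr0.le hu.le hw.le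
    have hgw0 := hrw0.trans_le hgw
    have hgw0' : 0 < g1 u' ^ w := Real.rpow_pos_of_pos hp0' w
    have h3 : |f - f'| / g1 u ^ w ≤ B * η ^ (1 - w / 2) := by
      calc |f - f'| / g1 u ^ w ≤ B * η / r ^ w := by gcongr
        _ = _ := by
          rw [hrw, mul_div_assoc]
          congr 1
          rw [Real.rpow_sub hη0, Real.rpow_one]
    have h4 : |f'| / g1 u' ^ w ≤ B := by
      rw [div_le_iff₀ hgw0']
      refine hf'.trans (mul_le_mul_of_nonneg_left ?_ hB)
      exact Real.rpow_le_rpow_of_exponent_ge hp0' hg1' hwp.le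
    have h5 : |g1 u' ^ w - g1 u ^ w| / g1 u ^ w ≤ η ^ (w / 2) := by
      have h6 := abs_rpow_sub_rpow_le hw (hwp.le.trans hp) hg0' hg0
      rw [abs_sub_comm (g1 u')] at h6
      calc _ ≤ η ^ w / r ^ w := by
            have h7 := Real.rpow_le_rpow (abs_nonneg _) hg hw.le
            exact div_le_div₀ (Real.rpow_nonneg hη0.le w) (h6.trans h7) hrw0 hgw
        _ = _ := by rw [hrw, ← Real.rpow_sub hη0]; congr 1; ring
    rw [gTilde_of_g1_pos hp0, gTilde_of_g1_pos hp0']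
    have h6 : f / g1 u ^ w - f' / g1 u' ^ w =
        (f - f') / g1 u ^ w + f' / g1 u' ^ w * ((g1 u' ^ w - g1 u ^ w) / g1 u ^ w) := by
      field_simp; ring
    rw [h6]
    refine (abs_add_le _ _).trans ?_
    rw [abs_mul, abs_div, abs_div, abs_div, abs_of_pos hgw0, abs_of_pos hgw0']
    have h7 : |f'| / g1 u' ^ w * (|g1 u' ^ w - g1 u ^ w| / g1 u ^ w) ≤ B * η ^ (w / 2) :=
      mul_le_mul h4 h5 (by positivity) hB
    have : 0 ≤ B * (2 * (2 * r) ^ (p - w)) := by positivity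
    linarith

/-- Pathwise modulus of continuity of the weighted processes, with a constant which does not
depend on the sample. -/
lemma exists_weighted_modulus_bound (hd : 2 ≤ d) {M L c : ℝ} (hM : 1 ≤ M) (hL : 1 ≤ L)
    (hc0 : 0 < c) (hc1 : c < 1) :
    ∃ B : ℝ, 0 ≤ B ∧ ∀ (p rt e τ ℓ : ℝ) (C G : (Fin d → ℝ) → ℝ) (Gj V : Fin d → ℝ → ℝ)
      (D : Fin d → (Fin d → ℝ) → ℝ), SampleBounds p M rt e τ ℓ C G Gj V →
      CopulaBounds C D L → ∀ w Δ : ℝ, 0 < w → w < p → τ ^ (1 - p) ≤ Δ → Δ ≤ 1 →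
      ∀ u u' : Fin d → ℝ, inCube u → inCube u' → dist u u' ≤ Δ →
        |(rt * (G u - C u) - ∑ j, D j u * (rt * (Gj j (u j) - u j))) / gTilde w u -
          (rt * (G u' - C u') - ∑ j, D j u' * (rt * (Gj j (u' j) - u' j))) / gTilde w u'| ≤
          B * (2 * (2 * (Δ ^ p) ^ (1 / 2 : ℝ)) ^ (p - w) +
            ((Δ ^ p) ^ (1 - w / 2) + (Δ ^ p) ^ (w / 2))) ∧
        ((∀ k, c * e ≤ u k ∧ u k ≤ 1 - c * e) → (∀ k, c * e ≤ u' k ∧ u' k ≤ 1 - c * e) →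
        |rt * (G (fun k => V k (u k)) - C u) / gTilde w u -
          rt * (G (fun k => V k (u' k)) - C u') / gTilde w u'| ≤
          B * (2 * (2 * (Δ ^ p) ^ (1 / 2 : ℝ)) ^ (p - w) +
            ((Δ ^ p) ^ (1 - w / 2) + (Δ ^ p) ^ (w / 2)))) := by
  obtain ⟨B₁, hB₁⟩ : ∃ B₁, B₁ = M + d * (M + M * L) := ⟨_, rfl⟩
  obtain ⟨B₂, hB₂⟩ : ∃ B₂, B₂ = (M + d * (M + 2)) + d * ((M + d * (M + 2)) + M * L) := ⟨_, rfl⟩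
  obtain ⟨B₃, hB₃⟩ : ∃ B₃, B₃ = 5 * M ^ 3 + d * (5 * M ^ 2 + 12 * M ^ 3 * L + 6 * M ^ 3) :=
    ⟨_, rfl⟩
  obtain ⟨B₄, hB₄⟩ : ∃ B₄, B₄ = (2 * d + (d + 1) * (M / c)) +
      ((M + d * (M + 2)) * (6 * M ^ 2) + M + d * (5 * M ^ 2 + 12 * M ^ 3 * L)) := ⟨_, rfl⟩
  have h₁ : 0 ≤ B₁ := by rw [hB₁]; positivity
  have h₂ : 0 ≤ B₂ := by rw [hB₂]; positivity
  have h₃ : 0 ≤ B₃ := by rw [hB₃]; positivity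
  have h₄ : 0 ≤ B₄ := by rw [hB₄]; positivity
  refine ⟨B₁ + B₂ + 2 * B₃ + B₄, by positivity, ?_⟩
  intro p rt e τ ℓ C G Gj V D S hC w Δ hw hwp hτΔ hΔ1 u u' hu hu' hdist
  have hp0 := S.p_pos
  have hp1 : p ≤ 1 := by linarith [S.p_lt]
  have hΔ0 : 0 < Δ := (Real.rpow_pos_of_pos S.t_pos _).trans_le hτΔ
  have hτ : τ ≤ τ ^ (1 - p) := by
    simpa using Real.rpow_le_rpow_of_exponent_ge S.t_pos S.t_le (by linarith : 1 - p ≤ 1)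
  have heΔ : e ≤ Δ := S.e_le.trans (hτ.trans hτΔ)
  have hη0 : 0 < Δ ^ p := Real.rpow_pos_of_pos hΔ0 p
  have hη1 : Δ ^ p ≤ 1 := Real.rpow_le_one hΔ0.le hΔ1 hp0.le
  have hΔη : Δ ≤ Δ ^ p := by
    simpa using Real.rpow_le_rpow_of_exponent_ge hΔ0 hΔ1 hp1
  have hg : |g1 u - g1 u'| ≤ Δ ^ p := (abs_g1_sub_le hd u u').trans (hdist.trans hΔη)
  have hgp : ∀ v : Fin d → ℝ, inCube v → 0 ≤ g1 v ^ p := fun v hv =>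
    Real.rpow_nonneg (g1_nonneg hd hv) p
  have hlin := S.abs_linearized_sub_le_of_dist hC hu hu' hdist heΔ
  rw [← hB₁] at hlin
  refine ⟨?_, fun hcu hcu' => ?_⟩
  · have hb : ∀ v : Fin d → ℝ, inCube v →
        |rt * (G v - C v) - ∑ j, D j v * (rt * (Gj j (v j) - v j))| ≤
          (B₁ + B₂ + 2 * B₃ + B₄) * g1 v ^ p := fun v hv =>
      (S.abs_linearized_le hC hd hv).trans
        (mul_le_mul_of_nonneg_right (by rw [← hB₂]; linarith) (hgp v hv))
    refine abs_div_gTilde_sub_le hw hwp hp1 (by positivity) hη0 hη1 (g1_nonneg hd hu)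
      (g1_nonneg hd hu') (g1_le_one hd hu') hg (hb u hu) (hb u' hu') (hlin.trans ?_)
    exact mul_le_mul_of_nonneg_right (by linarith) hη0.le
  · have he : 0 < c * e := mul_pos hc0 S.e_pos
    have hI : ∀ v : Fin d → ℝ, (∀ k, c * e ≤ v k ∧ v k ≤ 1 - c * e) → ∀ k, v k ∈ Ioo (0 : ℝ) 1 :=
      fun v hv k => ⟨he.trans_le (hv k).1, by linarith [(hv k).2]⟩
    have hb : ∀ v : Fin d → ℝ, inCube v → (∀ k, c * e ≤ v k ∧ v k ≤ 1 - c * e) →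
        |rt * (G (fun k => V k (v k)) - C v)| ≤
          (B₁ + B₂ + 2 * B₃ + B₄) * g1 v ^ p := fun v hv hcv =>
      (S.abs_copula_process_le hC hd (hI v hcv) hc0 hc1 (le_g1 hd hcv)).trans
        (mul_le_mul_of_nonneg_right (by rw [← hB₄]; linarith) (hgp v hv))
    have hcl : ∀ v : Fin d → ℝ, (∀ k, c * e ≤ v k ∧ v k ≤ 1 - c * e) →
        |rt * (G (fun k => V k (v k)) - C v) -
          (rt * (G v - C v) - ∑ j, D j v * (rt * (Gj j (v j) - v j)))| ≤ B₃ * Δ ^ p :=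
      fun v hcv => by
        rw [hB₃]
        refine (S.abs_copula_process_sub_linearized_le hC (hI v hcv)).trans ?_
        rw [← hB₃]
        have := Real.rpow_le_rpow (Real.rpow_nonneg S.t_pos.le _) hτΔ hp0.le
        gcongr
    have h1 := abs_le.1 (hcl u hcu)
    have h2 := abs_le.1 (hcl u' hcu')
    have h3 := abs_le.1 hlin
    refine abs_div_gTilde_sub_le hw hwp hp1 (by positivity) hη0 hη1 (g1_nonneg hd hu)
      (g1_nonneg hd hu') (g1_le_one hd hu') hg (hb u hu hcu) (hb u' hu' hcu') ?_
    have h5 : 0 ≤ B₂ * Δ ^ p := by positivity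
    have h6 : 0 ≤ B₄ * Δ ^ p := by positivity
    rw [abs_le]; constructor <;> linarith

/-- The modulus of continuity obtained from a bound of order `Δ^p` vanishes as `Δ → 0`. -/
lemma tendsto_weighted_modulus {p w B : ℝ} (hw : 0 < w) (hwp : w < p) (hp : p ≤ 1) {Δ : ℕ → ℝ}
    (hΔ : Tendsto Δ atTop (nhds 0)) :
    Tendsto (fun n => B * (2 * (2 * (Δ n ^ p) ^ (1 / 2 : ℝ)) ^ (p - w) +
      ((Δ n ^ p) ^ (1 - w / 2) + (Δ n ^ p) ^ (w / 2)))) atTop (nhds 0) := by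
  have key : ∀ {f : ℕ → ℝ} {q : ℝ}, 0 < q → Tendsto f atTop (nhds 0) →
      Tendsto (fun n => f n ^ q) atTop (nhds 0) := by
    intro f q hq hf
    simpa [Real.zero_rpow hq.ne'] using hf.rpow_const (Or.inr hq.le)
  have h := key (hw.trans hwp) hΔ
  have h1 := key (by linarith : 0 < p - w)
    (by simpa using (key (by norm_num : (0 : ℝ) < 1 / 2) h).const_mul 2)
  have h2 := key (by linarith : 0 < 1 - w / 2) h
  have h3 := key (by linarith : 0 < w / 2) h
  simpa using ((h1.const_mul 2).add (h2.add h3)).const_mul B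

/-- Lipschitz bound for the partial derivatives away from the boundary. -/
lemma exists_abs_Cdot_sub_le {C : (Fin d → ℝ) → ℝ} (hC : Condition21 C)
    (h01 : ∀ j u, Cdot C j u ∈ Icc (0 : ℝ) 1) :
    ∃ L : ℝ, 1 ≤ L ∧ ∀ j x y, inCube x → inCube y → 0 < x j → x j < 1 →
      |Cdot C j x - Cdot C j y| ≤ L * dist x y / (x j * (1 - x j)) := by
  obtain ⟨-, hcontD, Cdd, hder, -, K, hK, hKb⟩ := hC
  refine ⟨2 + d * (2 * K), ?_, ?_⟩
  · have : 0 ≤ d * (2 * K) := by positivity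
    linarith
  intro j x y hx hy hj0 hj1
  have hq : 0 < x j * (1 - x j) := mul_pos hj0 (by linarith)
  have hδ : 0 ≤ dist x y := dist_nonneg
  rcases le_or_gt (x j * (1 - x j) / 2) (dist x y) with h | h
  · have h1 : |Cdot C j x - Cdot C j y| ≤ 1 := by
      rw [abs_le]; constructor <;> linarith [(h01 j x).1, (h01 j x).2, (h01 j y).1, (h01 j y).2]
    refine h1.trans ?_
    rw [le_div_iff₀ hq]
    have : 0 ≤ d * (2 * K) * dist x y := by positivity
    linarith
  · have hcoord : ∀ k, |y k - x k| ≤ dist x y := fun k => by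
      rw [dist_comm, ← Real.dist_eq]; exact dist_le_pi_dist y x k
    have hbetween : ∀ t ∈ uIcc (x j) (y j), 0 < t ∧ t < 1 ∧
        x j * (1 - x j) / 2 ≤ t * (1 - t) := by
      intro t ht
      have h1 := (Set.abs_sub_left_of_mem_uIcc ht).trans ((hcoord j).trans h.le)
      have h2 := abs_le.1 h1
      have ht0 : 0 < t := by nlinarith
      have ht1 : t < 1 := by nlinarith
      exact ⟨ht0, ht1, mul_one_sub_le_two_mul hj0.le hj1.le ht0.le ht1.le h1⟩
    rw [abs_sub_comm]
    have hsum := abs_sub_le_sum_coordinate (Cdot C j) x y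
      (fun _ => 2 * K * dist x y / (x j * (1 - x j))) (by
        intro k z hz
        have hzI : ∀ i, z i ∈ uIcc (x i) (y i) := by
          intro i
          rcases hz i with e | e <;> rw [e] <;> simp
        have hsub : ∀ i, uIcc (x i) (y i) ⊆ Icc (0 : ℝ) 1 := fun i =>
          ordConnected_Icc.uIcc_subset (hx i) (hy i)
        by_cases hxy : x k = y k
        · rw [hxy, sub_self, abs_zero]; positivity
        have hupd : ∀ t ∈ uIcc (x k) (y k), ∀ i, Function.update z k t i ∈ uIcc (x i) (y i) := by
          intro t ht i
          by_cases hi : i = k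
          · subst hi; simpa using ht
          · simpa [hi] using hzI i
        have hmem : ∀ t ∈ uIcc (x k) (y k), Function.update z k t ∈ VV d j := fun t ht =>
          ⟨fun i => hsub i (hupd t ht i), (hbetween _ (hupd t ht j)).1,
            (hbetween _ (hupd t ht j)).2.1⟩
        have hIoo : ∀ t ∈ Ioo (min (x k) (y k)) (max (x k) (y k)),
            Function.update z k t ∈ VV d k ∩ VV d j := by
          intro t ht
          refine ⟨⟨fun i => hsub i (hupd t (Ioo_subset_Icc_self ht) i), ?_, ?_⟩,
            hmem t (Ioo_subset_Icc_self ht)⟩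
          · rw [Function.update_self]
            exact (le_min (hx k).1 (hy k).1).trans_lt ht.1
          · rw [Function.update_self]
            exact ht.2.trans_le (max_le (hx k).2 (hy k).2)
        have hcu : Continuous fun t : ℝ => Function.update z k t :=
          continuous_const.update k continuous_id
        obtain ⟨t, ht, he⟩ := exists_mem_uIcc_hasDerivAt_eq
          (f := fun t => Cdot C j (Function.update z k t))
          (f' := fun t => Cdd k j (Function.update z k t))
          ((hcontD j).comp hcu.continuousOn hmem)
          (fun t ht => by simpa using hder k j _ (hIoo t ht)) hxy
        have hb := hKb k j _ (hIoo t ht)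
        have h3 := (hbetween _ (hupd t (Ioo_subset_Icc_self ht) j)).2.2
        set s := Function.update z k t j
        rw [he, abs_mul]
        calc _ ≤ (K * (1 / (s * (1 - s)))) * dist x y := by
              refine mul_le_mul (hb.trans ?_) (hcoord k) (abs_nonneg _) ?_
              · exact mul_le_mul_of_nonneg_left (min_le_right _ _) hK.le
              · have : 0 < s * (1 - s) := by linarith
                positivity
          _ ≤ (K * (1 / (x j * (1 - x j) / 2))) * dist x y := by gcongr
          _ = _ := by field_simp)
    refine hsum.trans ?_
    rw [Finset.sum_const, Finset.card_univ, Fintype.card_fin, nsmul_eq_mul, ← mul_div_assoc]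
    exact div_le_div_of_nonneg_right (by linarith) hq.le

lemma measurable_Uv {P : Measure Ω} {X : ℤ → Ω → Fin d → ℝ}
    (hcont : ∀ j, Continuous (margF P X j)) {i : ℤ}
    (hX : Measurable (X i)) (j : Fin d) : Measurable fun ω => Uv P X i ω j :=
  (hcont j).measurable.comp ((measurable_pi_apply j).comp hX)

section Margins

variable {P : Measure Ω} [IsProbabilityMeasure P] {X : ℤ → Ω → Fin d → ℝ}

lemma margF_eq_cdf (hX : Measurable (X 0)) (j : Fin d) (x : ℝ) :
    margF P X j x = ProbabilityTheory.cdf (P.map fun ω => X 0 ω j) x := by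
  have hm : Measurable fun ω => X 0 ω j := (measurable_pi_apply j).comp hX
  have := Measure.isProbabilityMeasure_map (μ := P) hm.aemeasurable
  rw [ProbabilityTheory.cdf_eq_real, measureReal_def, Measure.map_apply hm measurableSet_Iic]
  rfl

lemma Uv_mem_Icc (i : ℤ) (ω : Ω) (j : Fin d) : Uv P X i ω j ∈ Icc (0 : ℝ) 1 :=
  ⟨ENNReal.toReal_nonneg, measureReal_le_one⟩

lemma exists_margF_eq (hX : Measurable (X 0)) (hcont : ∀ j, Continuous (margF P X j))
    (j : Fin d) {s : ℝ} (hs0 : 0 < s) (hs1 : s < 1) : ∃ x, margF P X j x = s := by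
  refine mem_range_of_exists_le_of_exists_ge (hcont j) ?_ ?_
  · have h := ProbabilityTheory.tendsto_cdf_atBot (P.map fun ω => X 0 ω j)
    obtain ⟨x, hx⟩ := (h.eventually_lt_const hs0).exists
    exact ⟨x, by rw [margF_eq_cdf hX]; exact hx.le⟩
  · have h := ProbabilityTheory.tendsto_cdf_atTop (P.map fun ω => X 0 ω j)
    obtain ⟨x, hx⟩ := (h.eventually_const_lt hs1).exists
    exact ⟨x, by rw [margF_eq_cdf hX]; exact hx.le⟩

/-- The probability integral transform. -/
lemma real_Uv_le (hX : Measurable (X 0)) (hcont : ∀ j, Continuous (margF P X j)) (j : Fin d)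
    {s : ℝ} (hs0 : 0 ≤ s) (hs1 : s ≤ 1) : P.real {ω | Uv P X 0 ω j ≤ s} = s := by
  have hmono : Monotone (margF P X j) := fun x y hxy => by
    rw [margF_eq_cdf hX, margF_eq_cdf hX]
    exact ProbabilityTheory.monotone_cdf _ hxy
  apply le_antisymm
  · refine le_of_forall_gt_imp_ge_of_dense fun t hst => ?_
    rcases lt_or_ge t 1 with ht | ht
    · obtain ⟨x, hx⟩ := exists_margF_eq hX hcont j (hs0.trans_lt hst) ht
      have hsub : {ω | Uv P X 0 ω j ≤ s} ⊆ {ω | X 0 ω j ≤ x} := by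
        intro ω hω
        by_contra hlt
        have h1 : t ≤ Uv P X 0 ω j := hx ▸ hmono (not_le.1 hlt).le
        exact absurd (h1.trans hω) (not_le.2 hst)
      exact (measureReal_mono hsub).trans hx.le
    · exact measureReal_le_one.trans ht
  · rcases hs0.eq_or_lt with h0 | h0
    · rw [← h0]; exact measureReal_nonneg
    rcases hs1.eq_or_lt with h1 | h1
    · have : {ω | Uv P X 0 ω j ≤ s} = univ := by
        ext ω; simpa [h1] using (Uv_mem_Icc 0 ω j).2
      rw [this, h1, probReal_univ]
    · obtain ⟨x, hx⟩ := exists_margF_eq hX hcont j h0 h1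
      calc s = P.real {ω | X 0 ω j ≤ x} := hx.symm
        _ ≤ _ := measureReal_mono fun ω (hω : X 0 ω j ≤ x) => (hmono hω).trans hx.le

lemma real_Uv_le_eq_clamp (hX : Measurable (X 0)) (hcont : ∀ j, Continuous (margF P X j))
    (j : Fin d) (s : ℝ) : P.real {ω | Uv P X 0 ω j ≤ s} = max 0 (min s 1) := by
  rcases le_or_gt 0 s with h0 | h0
  · rcases le_or_gt s 1 with h1 | h1
    · rw [real_Uv_le hX hcont j h0 h1, min_eq_left h1, max_eq_right h0]
    · have : {ω | Uv P X 0 ω j ≤ s} = univ := by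
        ext ω; simpa using (Uv_mem_Icc 0 ω j).2.trans h1.le
      rw [this, probReal_univ, min_eq_right h1.le, max_eq_right zero_le_one]
  · have : {ω | Uv P X 0 ω j ≤ s} = ∅ := by
      ext ω; simpa using h0.trans_le (Uv_mem_Icc 0 ω j).1
    rw [this, measureReal_empty, max_eq_left ((min_le_left _ _).trans h0.le)]

lemma cop_update_mono (u : Fin d → ℝ) (j : Fin d) {s t : ℝ} (hst : s ≤ t) :
    cop P X (Function.update u j s) ≤ cop P X (Function.update u j t) := by
  refine measureReal_mono (μ := P) fun ω hω k => (hω k).trans ?_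
  by_cases hk : k = j
  · subst hk; simpa using hst
  · simp [hk]

lemma cop_update_sub_le (hX : Measurable (X 0)) (hcont : ∀ j, Continuous (margF P X j))
    (u : Fin d → ℝ) (j : Fin d) {s t : ℝ} (hst : s ≤ t) :
    cop P X (Function.update u j t) - cop P X (Function.update u j s) ≤ t - s := by
  have hsub : {ω | ∀ k, Uv P X 0 ω k ≤ Function.update u j t k} ⊆
      {ω | ∀ k, Uv P X 0 ω k ≤ Function.update u j s k} ∪
        ({ω | Uv P X 0 ω j ≤ t} \ {ω | Uv P X 0 ω j ≤ s}) := by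
    intro ω hω
    by_cases h : Uv P X 0 ω j ≤ s
    · left
      intro k
      by_cases hk : k = j
      · subst hk; simpa using h
      · simpa [hk] using hω k
    · right
      exact ⟨by simpa using hω j, h⟩
  have h1 := (measureReal_mono (μ := P) hsub).trans (measureReal_union_le _ _)
  have h2 : P.real ({ω | Uv P X 0 ω j ≤ t} \ {ω | Uv P X 0 ω j ≤ s}) =
      max 0 (min t 1) - max 0 (min s 1) := by
    have hsub' : {ω | Uv P X 0 ω j ≤ s} ⊆ {ω | Uv P X 0 ω j ≤ t} := fun ω hω => le_trans hω hst
    rw [measureReal_sdiff hsub' (measurableSet_le (measurable_Uv hcont hX j) measurable_const),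
      real_Uv_le_eq_clamp hX hcont, real_Uv_le_eq_clamp hX hcont]
  have h3 : max 0 (min t 1) - max 0 (min s 1) ≤ t - s := by
    rcases le_total t 1 with h | h <;> rcases le_total s 1 with h' | h' <;>
      rcases le_total 0 t with h₂ | h₂ <;> rcases le_total 0 s with h₃ | h₃ <;>
      simp only [min_eq_left, min_eq_right, max_eq_left, max_eq_right, zero_le_one, *] <;> linarith
  change cop P X _ ≤ cop P X _ + _ at h1
  linarith

lemma abs_cop_update_sub_le (hX : Measurable (X 0)) (hcont : ∀ j, Continuous (margF P X j))
    (u : Fin d → ℝ) (j : Fin d) (s t : ℝ) :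
    |cop P X (Function.update u j t) - cop P X (Function.update u j s)| ≤ |t - s| := by
  rcases le_total s t with h | h
  · rw [abs_of_nonneg (sub_nonneg.2 (cop_update_mono u j h)), abs_of_nonneg (by linarith)]
    exact cop_update_sub_le hX hcont u j h
  · rw [abs_sub_comm, abs_sub_comm t,
      abs_of_nonneg (sub_nonneg.2 (cop_update_mono u j h)), abs_of_nonneg (by linarith)]
    exact cop_update_sub_le hX hcont u j h

lemma cop_eq_zero (hX : Measurable (X 0)) (hcont : ∀ j, Continuous (margF P X j))
    {u : Fin d → ℝ} {j : Fin d} (hj : u j = 0) : cop P X u = 0 := by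
  apply le_antisymm _ measureReal_nonneg
  calc cop P X u ≤ P.real {ω | Uv P X 0 ω j ≤ 0} :=
        measureReal_mono (μ := P) fun ω hω => (hω j).trans hj.le
    _ = 0 := real_Uv_le hX hcont j le_rfl zero_le_one

lemma cop_update_one (hX : Measurable (X 0)) (hcont : ∀ j, Continuous (margF P X j))
    (j : Fin d) {s : ℝ} (hs0 : 0 ≤ s) (hs1 : s ≤ 1) :
    cop P X (Function.update (fun _ => (1 : ℝ)) j s) = s := by
  have h : {ω | ∀ k, Uv P X 0 ω k ≤ Function.update (fun _ => (1 : ℝ)) j s k} =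
      {ω | Uv P X 0 ω j ≤ s} := by
    ext ω
    constructor
    · intro h; simpa using h j
    · intro h k
      by_cases hk : k = j
      · subst hk; simpa using h
      · simpa [hk] using (Uv_mem_Icc 0 ω k).2
  change P.real _ = s
  rw [h, real_Uv_le hX hcont j hs0 hs1]

lemma cop_slope_mem (hX : Measurable (X 0)) (hcont : ∀ j, Continuous (margF P X j))
    (j : Fin d) (u : Fin d → ℝ) (h : ℝ) :
    (cop P X (Function.update u j (u j + h)) - cop P X u) / h ∈ Icc (0 : ℝ) 1 := by
  have hu : cop P X u = cop P X (Function.update u j (u j)) := by rw [Function.update_eq_self]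
  rw [hu]
  rcases lt_trichotomy h 0 with hh | hh | hh
  · have h1 := cop_update_mono (P := P) (X := X) u j (by linarith : u j + h ≤ u j)
    have h2 := cop_update_sub_le hX hcont u j (by linarith : u j + h ≤ u j)
    exact ⟨div_nonneg_of_nonpos (by linarith) hh.le, (div_le_one_of_neg hh).2 (by linarith)⟩
  · simp [hh]
  · have h1 := cop_update_mono (P := P) (X := X) u j (by linarith : u j ≤ u j + h)
    have h2 := cop_update_sub_le hX hcont u j (by linarith : u j ≤ u j + h)
    exact ⟨div_nonneg (by linarith) hh.le, (div_le_one hh).2 (by linarith)⟩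

lemma Cdot_mem_Icc (hX : Measurable (X 0)) (hcont : ∀ j, Continuous (margF P X j))
    (j : Fin d) (u : Fin d → ℝ) : Cdot (cop P X) j u ∈ Icc (0 : ℝ) 1 := by
  have h := cop_slope_mem hX hcont j u
  have hle : IsBoundedUnder (· ≤ ·) (nhdsWithin 0 {(0 : ℝ)}ᶜ)
      (fun h : ℝ => (cop P X (Function.update u j (u j + h)) - cop P X u) / h) :=
    isBoundedUnder_of ⟨1, fun t => (h t).2⟩
  have hge : IsBoundedUnder (· ≥ ·) (nhdsWithin 0 {(0 : ℝ)}ᶜ)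
      (fun h : ℝ => (cop P X (Function.update u j (u j + h)) - cop P X u) / h) :=
    isBoundedUnder_of ⟨0, fun t => (h t).1⟩
  exact ⟨le_limsup_of_frequently_le (Frequently.of_forall fun t => (h t).1) hle,
    limsup_le_of_le hge.isCoboundedUnder_le (Eventually.of_forall fun t => (h t).2)⟩

lemma Cdot_eq_zero (hX : Measurable (X 0)) (hcont : ∀ j, Continuous (margF P X j))
    {j k : Fin d} {u : Fin d → ℝ} (hkj : k ≠ j) (hj : u j = 0) : Cdot (cop P X) k u = 0 := by
  have h : (fun h : ℝ => (cop P X (Function.update u k (u k + h)) - cop P X u) / h) =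
      fun _ => 0 := by
    funext h
    rw [cop_eq_zero hX hcont hj, cop_eq_zero hX hcont (j := j)]
    · simp
    · rw [Function.update_of_ne hkj.symm, hj]
  rw [Cdot, h, limsup_const]

lemma Cdot_update_one (hX : Measurable (X 0)) (hcont : ∀ j, Continuous (margF P X j))
    (hC : Condition21 (cop P X)) (j : Fin d) {s : ℝ} (hs0 : 0 < s) (hs1 : s < 1) :
    Cdot (cop P X) j (Function.update (fun _ => (1 : ℝ)) j s) = 1 := by
  have hmem : Function.update (fun _ => (1 : ℝ)) j s ∈ VV d j :=
    ⟨inCube_one.update j hs0.le hs1.le, by simpa using hs0, by simpa using hs1⟩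
  have h := hC.1 j _ hmem
  simp only [Function.update_idem, Function.update_self] at h
  refine h.unique ((hasDerivAt_id s).congr_of_eventuallyEq ?_)
  filter_upwards [Ioo_mem_nhds hs0 hs1] with t ht
  exact cop_update_one hX hcont j ht.1.le ht.2.le

lemma exists_copulaBounds (hX : Measurable (X 0)) (hcont : ∀ j, Continuous (margF P X j))
    (hC : Condition21 (cop P X)) : ∃ L, CopulaBounds (cop P X) (Cdot (cop P X)) L := by
  obtain ⟨L, hL, hLb⟩ := exists_abs_Cdot_sub_le hC (Cdot_mem_Icc hX hcont)
  exact ⟨L, {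
    one_le := hL
    nonneg := fun _ => ENNReal.toReal_nonneg
    lip := abs_cop_update_sub_le hX hcont
    zero := fun _ _ => cop_eq_zero hX hcont
    one := fun j _ => cop_update_one hX hcont j
    D_nonneg := fun j u => (Cdot_mem_Icc hX hcont j u).1
    D_le_one := fun j u => (Cdot_mem_Icc hX hcont j u).2
    D_zero := fun _ _ _ => Cdot_eq_zero hX hcont
    D_one := fun j _ => Cdot_update_one hX hcont hC j
    deriv := hC.1
    D_sub := hLb }⟩

end Margins

/-- All coordinates of `U_1,…,U_n` lie in the open unit interval. -/
def InteriorSample (P : Measure Ω) (X : ℤ → Ω → Fin d → ℝ) (n : ℕ) (ω : Ω) : Prop :=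
  ∀ i ∈ Finset.Icc (1 : ℤ) n, ∀ j, Uv P X i ω j ∈ Ioo (0 : ℝ) 1

section Empirical

variable {P : Measure Ω} {X : ℤ → Ω → Fin d → ℝ} {n : ℕ} {ω : Ω}

lemma indic_setOf {α : Type*} (p : α → Prop) (x : α) [Decidable (p x)] :
    indic {y | p y} x = if p x then 1 else 0 := by
  classical
  simp [indic, Set.indicator_apply]

lemma indic_nonneg {α : Type*} (s : Set α) (x : α) : 0 ≤ indic s x :=
  indicator_nonneg (fun _ _ => zero_le_one) x

lemma indic_le_one {α : Type*} (s : Set α) (x : α) : indic s x ≤ 1 :=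
  indicator_le_self' (f := fun _ => (1 : ℝ)) (fun _ _ => zero_le_one) x

lemma inv_mul_sum_const (hn : 0 < n) (c : ℝ) :
    (n : ℝ)⁻¹ * ∑ _i ∈ Finset.Icc (1 : ℤ) (n : ℤ), c = c := by
  have : (n : ℝ) ≠ 0 := by positivity
  rw [Finset.sum_const, Int.card_Icc, nsmul_eq_mul]
  simp
  field_simp

lemma Gnj_mono {j : Fin d} {s t : ℝ} (hst : s ≤ t) : Gnj P X n j s ω ≤ Gnj P X n j t ω := by
  classical
  unfold Gnj
  gcongr with i
  rw [indic_setOf, indic_setOf]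
  split_ifs with h1 h2
  · exact le_rfl
  · exact absurd (h1.trans hst) h2
  · exact zero_le_one
  · exact le_rfl

lemma Gn_nonneg (u : Fin d → ℝ) : 0 ≤ Gn P X n u ω :=
  mul_nonneg (by positivity) (Finset.sum_nonneg fun _ _ => indic_nonneg _ _)

lemma Gn_le_one (hn : 0 < n) (u : Fin d → ℝ) : Gn P X n u ω ≤ 1 := by
  rw [← inv_mul_sum_const hn 1]
  unfold Gn
  gcongr with i
  exact indic_le_one _ _

lemma abs_Gn_update_sub_le (u : Fin d → ℝ) (j : Fin d) (s t : ℝ) :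
    |Gn P X n (Function.update u j t) ω - Gn P X n (Function.update u j s) ω| ≤
      |Gnj P X n j t ω - Gnj P X n j s ω| := by
  classical
  wlog hst : s ≤ t
  · rw [abs_sub_comm, abs_sub_comm (Gnj P X n j t ω)]
    exact this u j t s (not_le.1 hst).le
  have hiff : ∀ i r, (∀ k, Uv P X i ω k ≤ Function.update u j r k) ↔
      Uv P X i ω j ≤ r ∧ ∀ k, k ≠ j → Uv P X i ω k ≤ u k := by
    intro i r
    exact Function.forall_update_iff u fun k x => Uv P X i ω k ≤ x
  have hterm : ∀ i, indic {ω' | ∀ k, Uv P X i ω' k ≤ Function.update u j s k} ω ≤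
      indic {ω' | ∀ k, Uv P X i ω' k ≤ Function.update u j t k} ω ∧
      indic {ω' | ∀ k, Uv P X i ω' k ≤ Function.update u j t k} ω -
        indic {ω' | ∀ k, Uv P X i ω' k ≤ Function.update u j s k} ω ≤
      indic {ω' | Uv P X i ω' j ≤ t} ω - indic {ω' | Uv P X i ω' j ≤ s} ω := by
    intro i
    simp only [indic_setOf, hiff]
    by_cases h1 : Uv P X i ω j ≤ s
    · simp [h1, h1.trans hst]
    · by_cases h2 : Uv P X i ω j ≤ t
      · simp only [h1, h2, true_and, false_and, if_true, if_false]
        split_ifs <;> norm_num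
      · simp [h1, h2]
  have hn : (0 : ℝ) ≤ (n : ℝ)⁻¹ := by positivity
  rw [abs_of_nonneg (sub_nonneg.2 (Gnj_mono hst)), abs_of_nonneg]
  · unfold Gn Gnj
    rw [← mul_sub, ← mul_sub, ← Finset.sum_sub_distrib, ← Finset.sum_sub_distrib]
    exact mul_le_mul_of_nonneg_left (Finset.sum_le_sum fun i _ => (hterm i).2) hn
  · exact sub_nonneg.2 (mul_le_mul_of_nonneg_left (Finset.sum_le_sum fun i _ => (hterm i).1) hn)

lemma Gn_update_one [IsProbabilityMeasure P] (j : Fin d) (s : ℝ) :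
    Gn P X n (Function.update (fun _ => (1 : ℝ)) j s) ω = Gnj P X n j s ω := by
  classical
  unfold Gn Gnj
  congr 1
  refine Finset.sum_congr rfl fun i _ => ?_
  rw [indic_setOf, indic_setOf]
  congr 1
  rw [Function.forall_update_iff (fun _ => (1 : ℝ)) fun k x => Uv P X i ω k ≤ x]
  simp only [eq_iff_iff, and_iff_left_iff_imp]
  exact fun _ k _ => (Uv_mem_Icc i ω k).2

lemma Gn_eq_zero (hU : InteriorSample P X n ω) {u : Fin d → ℝ} {j : Fin d} (hj : u j = 0) :
    Gn P X n u ω = 0 := by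
  classical
  unfold Gn
  rw [Finset.sum_eq_zero, mul_zero]
  intro i hi
  rw [indic_setOf, if_neg]
  intro h
  have := h j
  rw [hj] at this
  exact absurd this (not_le.2 (hU i hi j).1)

lemma Gnj_eq_zero (hU : InteriorSample P X n ω) (j : Fin d) {s : ℝ} (hs : s ≤ 0) :
    Gnj P X n j s ω = 0 := by
  classical
  unfold Gnj
  rw [Finset.sum_eq_zero, mul_zero]
  intro i hi
  rw [indic_setOf, if_neg]
  exact fun h => absurd (h.trans hs) (not_le.2 (hU i hi j).1)

lemma Gnj_eq_one (hn : 0 < n) (j : Fin d) {s : ℝ}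
    (hs : ∀ i ∈ Finset.Icc (1 : ℤ) n, Uv P X i ω j ≤ s) : Gnj P X n j s ω = 1 := by
  classical
  rw [← inv_mul_sum_const hn 1]
  unfold Gnj
  congr 1
  refine Finset.sum_congr rfl fun i hi => ?_
  rw [indic_setOf, if_pos (hs i hi)]

lemma isClosed_le_Gnj (j : Fin d) (s : ℝ) : IsClosed {x | s ≤ Gnj P X n j x ω} := by
  classical
  have h : UpperSemicontinuous fun x =>
      ∑ i ∈ Finset.Icc (1 : ℤ) (n : ℤ), indic {ω' | Uv P X i ω' j ≤ x} ω := by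
    refine upperSemicontinuous_sum fun i _ => ?_
    have : (fun x => indic {ω' | Uv P X i ω' j ≤ x} ω) =
        (Ici (Uv P X i ω j)).indicator fun _ => (1 : ℝ) := by
      funext x
      simp [indic, Set.indicator_apply]
    rw [this]
    exact isClosed_Ici.upperSemicontinuous_indicator zero_le_one
  rcases Nat.eq_zero_or_pos n with h0 | h0
  · subst h0
    simp only [Gnj, Nat.cast_zero, inv_zero, zero_mul]
    exact isClosed_const
  have hn : (0 : ℝ) < n := by positivity
  have h' : {x | s ≤ Gnj P X n j x ω} = {x | n * s ≤
      ∑ i ∈ Finset.Icc (1 : ℤ) (n : ℤ), indic {ω' | Uv P X i ω' j ≤ x} ω} := by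
    ext x
    simp only [mem_ofPred_eq, Gnj]
    rw [le_inv_mul_iff₀ hn]
  rw [h']
  exact h.isClosed_preimage _

lemma genInv_of_pos {H : ℝ → ℝ} {s : ℝ} (hs : 0 < s) : genInv H s = sInf {x | s ≤ H x} :=
  if_neg hs.ne'

lemma bddBelow_le_Gnj (hU : InteriorSample P X n ω) (j : Fin d) {s : ℝ} (hs : 0 < s) :
    BddBelow {x | s ≤ Gnj P X n j x ω} :=
  ⟨0, fun x hx => by
    by_contra h
    have h' : s ≤ Gnj P X n j x ω := hx
    rw [Gnj_eq_zero hU j (not_le.1 h).le] at h'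
    linarith⟩

lemma exists_lt_one_Gnj_eq_one (hn : 0 < n) (hU : InteriorSample P X n ω) (j : Fin d) :
    ∃ x < 1, Gnj P X n j x ω = 1 := by
  have h : ∀ᶠ x in nhdsWithin (1 : ℝ) (Iio 1),
      ∀ i ∈ Finset.Icc (1 : ℤ) n, Uv P X i ω j ≤ x := by
    rw [Filter.eventually_all_finset]
    intro i hi
    filter_upwards [nhdsWithin_le_nhds (Ioi_mem_nhds (hU i hi j).2)] with x hx
    exact le_of_lt hx
  obtain ⟨x, hx, hx1⟩ := (h.and self_mem_nhdsWithin).exists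
  exact ⟨x, hx1, Gnj_eq_one hn j hx⟩

lemma nonempty_le_Gnj (hn : 0 < n) (hU : InteriorSample P X n ω) (j : Fin d) {s : ℝ} (hs : s < 1) :
    {x | s ≤ Gnj P X n j x ω}.Nonempty := by
  obtain ⟨x, -, hx⟩ := exists_lt_one_Gnj_eq_one hn hU j
  exact ⟨x, hs.le.trans hx.ge⟩

lemma le_Gnj_genInv (hn : 0 < n) (hU : InteriorSample P X n ω) (j : Fin d) {s : ℝ} (hs0 : 0 < s)
    (hs1 : s < 1) : s ≤ Gnj P X n j (genInv (fun x => Gnj P X n j x ω) s) ω := by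
  rw [genInv_of_pos hs0]
  exact (isClosed_le_Gnj j s).csInf_mem (nonempty_le_Gnj hn hU j hs1) (bddBelow_le_Gnj hU j hs0)

lemma genInv_mem_Ioo (hn : 0 < n) (hU : InteriorSample P X n ω) (j : Fin d) {s : ℝ} (hs0 : 0 < s)
    (hs1 : s < 1) : genInv (fun x => Gnj P X n j x ω) s ∈ Ioo (0 : ℝ) 1 := by
  have h := le_Gnj_genInv hn hU j hs0 hs1
  constructor
  · by_contra h0
    rw [Gnj_eq_zero hU j (not_lt.1 h0)] at h
    linarith
  · obtain ⟨x, hx1, hx⟩ := exists_lt_one_Gnj_eq_one hn hU j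
    rw [genInv_of_pos hs0]
    exact (csInf_le (bddBelow_le_Gnj hU j hs0) (hs1.le.trans hx.ge)).trans_lt hx1

lemma genInv_mono (hn : 0 < n) (hU : InteriorSample P X n ω) (j : Fin d) {s t : ℝ} (hs : 0 < s)
    (hst : s ≤ t) (ht : t < 1) :
    genInv (fun x => Gnj P X n j x ω) s ≤ genInv (fun x => Gnj P X n j x ω) t := by
  rw [genInv_of_pos hs, genInv_of_pos (hs.trans_le hst)]
  exact csInf_le_csInf (bddBelow_le_Gnj hU j hs) (nonempty_le_Gnj hn hU j ht)
    fun x hx => hst.trans hx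

lemma Gnj_lt_of_lt_genInv (hU : InteriorSample P X n ω) (j : Fin d) {s x : ℝ} (hs : 0 < s)
    (hx : x < genInv (fun x => Gnj P X n j x ω) s) : Gnj P X n j x ω < s := by
  rw [genInv_of_pos hs] at hx
  exact not_le.1 fun h => notMem_of_lt_csInf hx (bddBelow_le_Gnj hU j hs) h

lemma exists_abs_Gnj_sub_le (hn : 0 < n) (hU : InteriorSample P X n ω) (j : Fin d) :
    ∃ A : ℝ, 0 ≤ A ∧ ∀ s ∈ Ioo (0 : ℝ) 1, |Gnj P X n j s ω - s| ≤ A * (s * (1 - s)) := by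
  classical
  refine ⟨(n : ℝ)⁻¹ * ∑ i ∈ Finset.Icc (1 : ℤ) (n : ℤ),
    (Uv P X i ω j * (1 - Uv P X i ω j))⁻¹, ?_, ?_⟩
  · refine mul_nonneg (by positivity) (Finset.sum_nonneg fun i hi => ?_)
    exact inv_nonneg.2 (mul_nonneg (hU i hi j).1.le (sub_nonneg.2 (hU i hi j).2.le))
  intro s hs
  have hsum : Gnj P X n j s ω - s =
      Gnj P X n j s ω - (n : ℝ)⁻¹ * ∑ _i ∈ Finset.Icc (1 : ℤ) (n : ℤ), s := by
    rw [inv_mul_sum_const hn s]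
  rw [hsum]
  unfold Gnj
  rw [← mul_sub, ← Finset.sum_sub_distrib, abs_mul, abs_of_nonneg (by positivity), mul_assoc,
    Finset.sum_mul]
  refine mul_le_mul_of_nonneg_left ((Finset.abs_sum_le_sum_abs _ _).trans
    (Finset.sum_le_sum fun i hi => ?_)) (by positivity)
  obtain ⟨h0, h1⟩ := hU i hi j
  obtain ⟨hs0, hs1⟩ := hs
  have hq : 0 < Uv P X i ω j * (1 - Uv P X i ω j) := mul_pos h0 (by linarith)
  rw [indic_setOf, inv_mul_eq_div, le_div_iff₀ hq]
  split_ifs with h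
  · rw [abs_of_pos (by linarith)]
    nlinarith [mul_nonneg h0.le h0.le]
  · rw [zero_sub, abs_neg, abs_of_pos hs0]
    nlinarith [mul_pos h0 hs0, mul_nonneg (sub_nonneg.2 h1.le) (sub_nonneg.2 h1.le)]

end Empirical

/-- A value of a bounded nonnegative real function is at most its supremum. -/
lemma le_biSup_of_forall_le {ι : Type*} {S : Set ι} {f : ι → ℝ} {b : ℝ} (hf : ∀ s ∈ S, 0 ≤ f s)
    (hb : ∀ s ∈ S, f s ≤ b) {s : ι} (hs : s ∈ S) : f s ≤ ⨆ s ∈ S, f s := by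
  have hb0 : 0 ≤ b := (hf s hs).trans (hb s hs)
  refine le_ciSup_of_le ⟨b, ?_⟩ s ?_
  · rintro _ ⟨t, rfl⟩
    exact Real.iSup_le (fun ht => hb t ht) hb0
  · exact le_ciSup (f := fun _ : s ∈ S => f s) ⟨f s, by rintro _ ⟨_, rfl⟩; exact le_rfl⟩ hs

/-- A locally uniform smallness statement along all null sequences gives a uniform one. -/
lemma exists_pos_eventually_le_of_forall_tendsto {f : ℕ → ℝ → ℝ≥0∞}
    (h : ∀ δ : ℕ → ℝ, Tendsto δ atTop (nhds 0) → Tendsto (fun n => f n (δ n)) atTop (nhds 0))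
    {η : ℝ≥0∞} (hη : 0 < η) : ∃ a : ℝ, 0 < a ∧ ∀ᶠ n in atTop, f n a ≤ η := by
  by_contra! hcon
  have hfreq : ∀ k : ℕ, ∃ᶠ n in atTop, η < f n (1 / ((k : ℝ) + 1)) := fun k =>
    hcon _ (by positivity)
  obtain ⟨φ, hφ, hφf⟩ := extraction_forall_of_frequently hfreq
  have hδ : Tendsto (Function.extend φ (fun k : ℕ => 1 / ((k : ℝ) + 1)) 0) atTop (nhds 0) := by
    rw [Metric.tendsto_atTop]
    intro ε hε
    obtain ⟨K, hK⟩ := exists_nat_one_div_lt hε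
    refine ⟨φ K, fun n hn => ?_⟩
    by_cases hex : ∃ k, φ k = n
    · obtain ⟨k, rfl⟩ := hex
      have hKk : K ≤ k := hφ.le_iff_le.1 hn
      rw [hφ.injective.extend_apply, Real.dist_eq, sub_zero, abs_of_pos (by positivity)]
      refine lt_of_le_of_lt ?_ hK
      gcongr
    · rw [Function.extend_apply' _ _ _ hex]
      simpa using hε
  have hev := ((h _ hδ).comp hφ.tendsto_atTop).eventually_lt_const hη
  obtain ⟨k, hk⟩ := hev.exists
  have hk' := hφf k
  simp only [Function.comp_apply, hφ.injective.extend_apply] at hk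
  exact lt_asymm hk hk'

/-- A local Hölder-type estimate on the unit cube extends to the whole cube by chaining. -/
lemma abs_sub_le_of_local_holder {H : (Fin d → ℝ) → ℝ} {a e p : ℝ} {k : ℕ} (hk : 0 < k)
    (hka : 1 / (k : ℝ) ≤ a) (hp : 0 ≤ p) (he : 0 ≤ e)
    (h : ∀ u v, inCube u → inCube v → dist u v ≤ a → |H u - H v| ≤ (max (dist u v) e) ^ p)
    {u v : Fin d → ℝ} (hu : inCube u) (hv : inCube v) :
    |H u - H v| ≤ k * (max (dist u v) e) ^ p := by
  have hk' : (0 : ℝ) < k := by positivity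
  have huv : dist u v ≤ 1 := by
    refine (dist_pi_le_iff zero_le_one).2 fun i => ?_
    rw [Real.dist_eq, abs_le]
    constructor <;> linarith [(hu i).1, (hu i).2, (hv i).1, (hv i).2]
  let x : ℕ → Fin d → ℝ := fun m => AffineMap.lineMap u v ((m : ℝ) / k)
  have hx : ∀ m ≤ k, inCube (x m) := by
    intro m hm
    rw [inCube_iff] at hu hv ⊢
    refine (convex_Icc (0 : Fin d → ℝ) 1).lineMap_mem hu hv ⟨by positivity, ?_⟩
    rw [div_le_one hk']
    exact_mod_cast hm
  have hstep : ∀ m, dist (x m) (x (m + 1)) = dist u v / k := by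
    intro m
    simp only [x]
    rw [dist_lineMap_lineMap, Real.dist_eq, ← sub_div, Nat.cast_add, Nat.cast_one,
      sub_add_cancel_left, abs_div, abs_neg, abs_one, Nat.abs_cast]
    ring
  have hsum := dist_le_range_sum_of_dist_le (f := fun m => H (x m)) (n := k)
    (d := fun _ => (max (dist u v) e) ^ p) (fun {m} hm => by
      rw [Real.dist_eq]
      refine (h _ _ (hx m hm.le) (hx (m + 1) hm) ?_).trans ?_
      · rw [hstep]
        exact (div_le_div_of_nonneg_right huv hk'.le).trans hka
      · rw [hstep]
        refine Real.rpow_le_rpow (le_max_of_le_right he) (max_le_max_right _ ?_) hp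
        exact div_le_self dist_nonneg (by exact_mod_cast hk))
  have h0 : x 0 = u := by simp [x]
  have h1 : x k = v := by simp [x, hk'.ne']
  simp only [h0, h1, Finset.sum_const, Finset.card_range, nsmul_eq_mul, Real.dist_eq] at hsum
  exact hsum

section GoodEvent

variable {P : Measure Ω} {X : ℤ → Ω → Fin d → ℝ} {n : ℕ} {ω : Ω}

lemma map_eq_of_strictlyStationary (hmeas : ∀ i, Measurable (X i)) (hstat : StrictlyStationary P X)
    (i : ℤ) : P.map (X i) = P.map (X 0) := by
  have h := congrArg (Measure.map fun f : Fin 1 → Fin d → ℝ => f 0) (hstat 1 (fun _ => 0) i)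
  rw [Measure.map_map (measurable_pi_apply 0) (measurable_pi_lambda _ fun _ => hmeas _),
    Measure.map_map (measurable_pi_apply 0) (measurable_pi_lambda _ fun _ => hmeas _)] at h
  simpa [Function.comp_def] using h

lemma abs_alphanj_le_of_biSup_le (hn : 0 < n) (hU : InteriorSample P X n ω) {p A : ℝ}
    (hp0 : 0 < p) (hp1 : p ≤ 1) {j : Fin d}
    (h : ⨆ s ∈ Ioo (0 : ℝ) 1, |alphanj P X n j s ω| / (s * (1 - s)) ^ p ≤ A)
    {s : ℝ} (hs0 : 0 ≤ s) (hs1 : s ≤ 1) :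
    |alphanj P X n j s ω| ≤ A * (s * (1 - s)) ^ p := by
  rcases hs0.eq_or_lt with h0 | h0
  · simp [← h0, alphanj, Gnj_eq_zero hU j le_rfl, Real.zero_rpow hp0.ne']
  rcases hs1.eq_or_lt with h1 | h1
  · simp [h1, alphanj, Gnj_eq_one hn j fun i hi => (hU i hi j).2.le, Real.zero_rpow hp0.ne']
  obtain ⟨K, hK0, hK⟩ := exists_abs_Gnj_sub_le hn hU j
  have hq : ∀ s ∈ Ioo (0 : ℝ) 1, 0 < s * (1 - s) := fun s hs => mul_pos hs.1 (sub_pos.2 hs.2)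
  have hle := le_biSup_of_forall_le (S := Ioo (0 : ℝ) 1)
    (f := fun s => |alphanj P X n j s ω| / (s * (1 - s)) ^ p) (b := √n * K)
    (fun s hs => div_nonneg (abs_nonneg _) (Real.rpow_nonneg (hq s hs).le _))
    (fun s hs => by
      rw [div_le_iff₀ (Real.rpow_pos_of_pos (hq s hs) _), alphanj, abs_mul,
        abs_of_nonneg (Real.sqrt_nonneg _), mul_assoc]
      refine mul_le_mul_of_nonneg_left ((hK s hs).trans ?_) (Real.sqrt_nonneg _)
      refine mul_le_mul_of_nonneg_left ?_ hK0
      refine Real.self_le_rpow_of_le_one (hq s hs).le ?_ hp1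
      nlinarith [hs.1, hs.2]) (s := s) ⟨h0, h1⟩
  exact (div_le_iff₀ (Real.rpow_pos_of_pos (hq s ⟨h0, h1⟩) _)).1 (hle.trans h)

lemma abs_betanj_le_of_biSup_le (hn : 0 < n) (hU : InteriorSample P X n ω) {p A ℓ : ℝ}
    (hp0 : 0 < p) (hℓ : 0 < ℓ) {j : Fin d}
    (h : ⨆ s ∈ Ioo ℓ (1 - ℓ), |betanj P X n j s ω| / (s * (1 - s)) ^ p ≤ A)
    {s : ℝ} (hs0 : ℓ < s) (hs1 : s < 1 - ℓ) :
    |betanj P X n j s ω| ≤ A * (s * (1 - s)) ^ p := by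
  have hq : ∀ s ∈ Ioo ℓ (1 - ℓ), ℓ * ℓ ≤ s * (1 - s) := fun s hs =>
    mul_le_mul hs.1.le (by linarith [hs.2]) hℓ.le (hℓ.le.trans hs.1.le)
  have hℓ2 : 0 < ℓ * ℓ := mul_pos hℓ hℓ
  have hle := le_biSup_of_forall_le (S := Ioo ℓ (1 - ℓ))
    (f := fun s => |betanj P X n j s ω| / (s * (1 - s)) ^ p) (b := √n / (ℓ * ℓ) ^ p)
    (fun s hs => div_nonneg (abs_nonneg _) (Real.rpow_nonneg (hℓ2.le.trans (hq s hs)) _))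
    (fun s hs => by
      have hs0 : 0 < s := hℓ.trans hs.1
      have hs1 : s < 1 := by linarith [hs.2]
      have hv := genInv_mem_Ioo hn hU j hs0 hs1
      refine div_le_div₀ (Real.sqrt_nonneg _) ?_ (Real.rpow_pos_of_pos hℓ2 _)
        (Real.rpow_le_rpow hℓ2.le (hq s hs) hp0.le)
      rw [betanj, abs_mul, abs_of_nonneg (Real.sqrt_nonneg _)]
      refine mul_le_of_le_one_right (Real.sqrt_nonneg _) ?_
      rw [abs_le]
      constructor <;> linarith [hv.1, hv.2]) (s := s) ⟨hs0, hs1⟩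
  exact (div_le_iff₀ (Real.rpow_pos_of_pos (hℓ2.trans_le (hq s ⟨hs0, hs1⟩)) _)).1 (hle.trans h)

lemma sqrt_mul_inv_le (hn : 0 < n) {p : ℝ} (hp : p < 1 / 2) :
    √n * (n : ℝ)⁻¹ ≤ ((n : ℝ)⁻¹) ^ p := by
  have hn' : (0 : ℝ) < n := by positivity
  have hn1 : (1 : ℝ) ≤ n := by exact_mod_cast hn
  rw [Real.sqrt_eq_rpow, ← Real.rpow_neg_one, ← Real.rpow_add hn', ← Real.rpow_mul hn'.le]
  exact Real.rpow_le_rpow_of_exponent_le hn1 (by linarith)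

/-- A generalized quantile overshoots its level by at most the jump size of the empirical c.d.f. -/
lemma sqrt_mul_Gnj_genInv_sub_le (hn : 0 < n) (hU : InteriorSample P X n ω) {p K : ℝ}
    (hp : p < 1 / 2)
    (hα : ∀ j s t, 0 ≤ s → s ≤ 1 → 0 ≤ t → t ≤ 1 →
      |alphanj P X n j s ω - alphanj P X n j t ω| ≤ K * (max |s - t| (n : ℝ)⁻¹) ^ p)
    (j : Fin d) {s : ℝ} (hs0 : 0 < s) (hs1 : s < 1) :
    √n * (Gnj P X n j (genInv (fun x => Gnj P X n j x ω) s) ω - s) ≤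
      (K + 1) * ((n : ℝ)⁻¹) ^ p := by
  have hn' : (0 : ℝ) < (n : ℝ)⁻¹ := by positivity
  obtain ⟨hv0, hv1⟩ := genInv_mem_Ioo hn hU j hs0 hs1
  set v := genInv (fun x => Gnj P X n j x ω) s with hv
  set h := min v (n : ℝ)⁻¹ with hh
  have hh0 : 0 < h := lt_min hv0 hn'
  have hhv : h ≤ v := min_le_left _ _
  have hhn : h ≤ (n : ℝ)⁻¹ := min_le_right _ _
  have hlt : Gnj P X n j (v - h) ω < s :=
    Gnj_lt_of_lt_genInv hU j hs0 (by rw [← hv]; linarith)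
  have h1 := (le_abs_self _).trans
    (hα j v (v - h) hv0.le hv1.le (by linarith) (by linarith))
  rw [sub_sub_cancel, abs_of_pos hh0, max_eq_right hhn, alphanj, alphanj] at h1
  have h2 := sqrt_mul_inv_le hn hp
  have h3 : √n * h ≤ √n * (n : ℝ)⁻¹ := mul_le_mul_of_nonneg_left hhn (Real.sqrt_nonneg _)
  have h4 : √n * Gnj P X n j (v - h) ω ≤ √n * s :=
    mul_le_mul_of_nonneg_left hlt.le (Real.sqrt_nonneg _)
  linarith

variable [IsProbabilityMeasure P]

lemma ae_Uv_mem_Ioo (hmeas : ∀ i, Measurable (X i)) (hstat : StrictlyStationary P X)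
    (hcont : ∀ j, Continuous (margF P X j)) (i : ℤ) (j : Fin d) :
    ∀ᵐ ω ∂P, Uv P X i ω j ∈ Ioo (0 : ℝ) 1 := by
  have hS : MeasurableSet {x : Fin d → ℝ | margF P X j (x j) ∈ Ioo (0 : ℝ) 1} :=
    ((hcont j).measurable.comp (measurable_pi_apply j)) measurableSet_Ioo
  have h0 : ∀ᵐ ω ∂P, Uv P X 0 ω j ∈ Ioo (0 : ℝ) 1 := by
    have hle : ∀ᵐ ω ∂P, ¬ Uv P X 0 ω j ≤ 0 := by
      have h := real_Uv_le (hmeas 0) hcont j le_rfl zero_le_one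
      rw [measureReal_eq_zero_iff] at h
      exact measure_eq_zero_iff_ae_notMem.1 h
    have hge : P.real {ω | 1 ≤ Uv P X 0 ω j} = 0 := by
      refine le_antisymm (le_of_forall_pos_le_add fun ε hε => ?_) measureReal_nonneg
      rw [zero_add]
      rcases le_or_gt 1 ε with h | h
      · exact measureReal_le_one.trans h
      have hsub : {ω | 1 ≤ Uv P X 0 ω j} ⊆ {ω | Uv P X 0 ω j ≤ 1 - ε}ᶜ := fun ω hω h' => by
        have h1 : 1 ≤ Uv P X 0 ω j := hω
        have h2 : Uv P X 0 ω j ≤ 1 - ε := h'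
        linarith
      refine (measureReal_mono hsub).trans ?_
      rw [probReal_compl_eq_one_sub (measurableSet_le (measurable_Uv hcont (hmeas 0) j)
        measurable_const), real_Uv_le (hmeas 0) hcont j (by linarith) (by linarith)]
      linarith
    rw [measureReal_eq_zero_iff] at hge
    filter_upwards [hle, measure_eq_zero_iff_ae_notMem.1 hge] with ω h1 h2
    exact ⟨not_le.1 h1, not_le.1 h2⟩
  have h1 := (ae_map_iff (hmeas 0).aemeasurable hS).2 h0
  rw [← map_eq_of_strictlyStationary hmeas hstat i] at h1
  exact (ae_map_iff (hmeas i).aemeasurable hS).1 h1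

lemma ae_interiorSample (hmeas : ∀ i, Measurable (X i)) (hstat : StrictlyStationary P X)
    (hcont : ∀ j, Continuous (margF P X j)) (n : ℕ) : ∀ᵐ ω ∂P, InteriorSample P X n ω := by
  unfold InteriorSample
  rw [Filter.eventually_all_finset]
  intro i _
  rw [ae_all_iff]
  exact ae_Uv_mem_Ioo hmeas hstat hcont i

lemma abs_alphan_le (hn : 0 < n) (u : Fin d → ℝ) : |alphan P X n u ω| ≤ √n := by
  have h1 := Gn_nonneg (P := P) (X := X) (n := n) (ω := ω) u
  have h2 := Gn_le_one (P := P) (X := X) (ω := ω) hn u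
  have h3 : 0 ≤ cop P X u := ENNReal.toReal_nonneg
  have h4 : cop P X u ≤ 1 := measureReal_le_one
  rw [alphan, abs_mul, abs_of_nonneg (Real.sqrt_nonneg _)]
  refine mul_le_of_le_one_right (Real.sqrt_nonneg _) ?_
  rw [abs_le]
  constructor <;> linarith

lemma abs_alphan_sub_le_of_Mn_le_one (hn : 0 < n) {a p : ℝ} (hp : 0 < p)
    (h : Mn P X n a p ω ≤ 1) {u v : Fin d → ℝ} (hu : inCube u) (hv : inCube v)
    (huv : dist u v ≤ a) :
    |alphan P X n u ω - alphan P X n v ω| ≤ (max (dist u v) (n : ℝ)⁻¹) ^ p := by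
  have hn' : (0 : ℝ) < n := by positivity
  have hpos : 0 < (n : ℝ) ^ (-p) := by positivity
  have hle := le_biSup_of_forall_le (S := {q : (Fin d → ℝ) × (Fin d → ℝ) |
      q.1 ∈ Set.Icc 0 1 ∧ q.2 ∈ Set.Icc 0 1 ∧ dist q.1 q.2 ≤ a})
    (f := fun q => |alphan P X n q.1 ω - alphan P X n q.2 ω| /
      max (dist q.1 q.2 ^ p) ((n : ℝ) ^ (-p))) (b := (√n + √n) / (n : ℝ) ^ (-p))
    (fun q _ => div_nonneg (abs_nonneg _) (hpos.le.trans (le_max_right _ _)))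
    (fun q _ => div_le_div₀ (by positivity)
      ((abs_sub _ _).trans (add_le_add (abs_alphan_le hn _) (abs_alphan_le hn _))) hpos
      (le_max_right _ _))
    (s := (u, v)) ⟨inCube_iff.1 hu, inCube_iff.1 hv, huv⟩
  have h1 := hle.trans h
  rw [div_le_one (hpos.trans_le (le_max_right _ _))] at h1
  refine h1.trans (max_le ?_ ?_)
  · exact Real.rpow_le_rpow dist_nonneg (le_max_left _ _) hp.le
  · rw [Real.rpow_neg hn'.le, ← Real.inv_rpow hn'.le]
    exact Real.rpow_le_rpow (by positivity) (le_max_right _ _) hp.le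

lemma alphan_update_one (hX : Measurable (X 0)) (hcont : ∀ j, Continuous (margF P X j))
    (j : Fin d) {s : ℝ} (hs0 : 0 ≤ s) (hs1 : s ≤ 1) :
    alphan P X n (Function.update (fun _ => (1 : ℝ)) j s) ω = alphanj P X n j s ω := by
  rw [alphan, alphanj, Gn_update_one, cop_update_one hX hcont j hs0 hs1]

/-- The deterministic bounds hold on the event where the sample is interior and the weighted
suprema are bounded. -/
lemma sampleBounds_of_event (hX : Measurable (X 0)) (hcont : ∀ j, Continuous (margF P X j))
    (hn : 0 < n) (hU : InteriorSample P X n ω) {p lam a M : ℝ} {k : ℕ}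
    (hp0 : 0 < p) (hp : p < 1 / 2) (hlam : 1 / 2 + p ≤ lam)
    (hℓ : (n : ℝ) ^ (-lam) < 1 / 3) (hk : 0 < k) (hka : 1 / (k : ℝ) ≤ a) (hkM : (k : ℝ) + 1 ≤ M)
    (hMn : Mn P X n a p ω ≤ 1)
    (hα : ∀ j, ⨆ s ∈ Ioo (0 : ℝ) 1, |alphanj P X n j s ω| / (s * (1 - s)) ^ p ≤ M)
    (hβ : ∀ j, ⨆ s ∈ Ioo ((n : ℝ) ^ (-lam)) (1 - (n : ℝ) ^ (-lam)),
      |betanj P X n j s ω| / (s * (1 - s)) ^ p ≤ M) :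
    SampleBounds p M (√n) (n : ℝ)⁻¹ ((n : ℝ) ^ (-(1 / (2 * (1 - p))))) ((n : ℝ) ^ (-lam))
      (cop P X) (fun u => Gn P X n u ω) (fun j s => Gnj P X n j s ω)
      (fun j s => genInv (fun x => Gnj P X n j x ω) s) := by
  have hn' : (0 : ℝ) < n := by positivity
  have hn1 : (1 : ℝ) ≤ n := by exact_mod_cast hn
  have hq : 0 < 2 * (1 - p) := by linarith
  have hhold : ∀ u v, inCube u → inCube v → |alphan P X n u ω - alphan P X n v ω| ≤
      k * (max (dist u v) (n : ℝ)⁻¹) ^ p := fun u v hu hv =>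
    abs_sub_le_of_local_holder (H := fun u => alphan P X n u ω) hk hka hp0.le (by positivity)
      (fun u v hu hv huv => abs_alphan_sub_le_of_Mn_le_one hn hp0 hMn hu hv huv) hu hv
  have hαj : ∀ j s t, 0 ≤ s → s ≤ 1 → 0 ≤ t → t ≤ 1 →
      |alphanj P X n j s ω - alphanj P X n j t ω| ≤ k * (max |s - t| (n : ℝ)⁻¹) ^ p := by
    intro j s t hs0 hs1 ht0 ht1
    rw [← alphan_update_one hX hcont j hs0 hs1, ← alphan_update_one hX hcont j ht0 ht1]
    refine (hhold _ _ (inCube_one.update j hs0 hs1) (inCube_one.update j ht0 ht1)).trans ?_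
    gcongr
    rw [← Real.dist_eq]
    refine (dist_pi_le_iff dist_nonneg).2 fun i => ?_
    by_cases hi : i = j
    · subst hi; simp
    · simp [hi]
  exact {
    p_pos := hp0
    p_lt := hp
    one_le := by linarith [(Nat.cast_nonneg k : (0 : ℝ) ≤ k)]
    rt_pos := Real.sqrt_pos.2 hn'
    e_pos := by positivity
    l_pos := by positivity
    l_lt := hℓ
    l_le := by
      refine Real.rpow_le_rpow_of_exponent_le hn1 (neg_le_neg (le_trans ?_ hlam))
      rw [div_le_iff₀ hq]
      nlinarith
    e_le := by
      rw [← Real.rpow_neg_one]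
      refine Real.rpow_le_rpow_of_exponent_le hn1 (neg_le_neg ?_)
      rw [div_le_one hq]
      linarith
    t_le := Real.rpow_le_one_of_one_le_of_nonpos hn1 (by
      rw [neg_nonpos]; positivity)
    rt_mul := by
      rw [← Real.rpow_mul hn'.le, Real.sqrt_eq_rpow, ← Real.rpow_add hn']
      have : 1 - p ≠ 0 := by linarith
      have h : 1 / 2 + -(1 / (2 * (1 - p))) * (1 - p) = 0 := by field_simp; ring
      rw [h, Real.rpow_zero]
    nonneg := fun u => Gn_nonneg u
    lip := abs_Gn_update_sub_le
    zero := fun _ _ => Gn_eq_zero hU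
    one := Gn_update_one
    Gj_zero := fun j => Gnj_eq_zero hU j le_rfl
    Gj_one := fun j => Gnj_eq_one hn j fun i hi => (hU i hi j).2.le
    hold := fun u v hu hv => (hhold u v hu hv).trans
      (mul_le_mul_of_nonneg_right (by linarith) (by positivity))
    marg := fun j s hs0 hs1 => abs_alphanj_le_of_biSup_le hn hU hp0 (by linarith) (hα j) hs0 hs1
    V_mem := fun j s => genInv_mem_Ioo hn hU j
    V_mono := fun j s t => genInv_mono hn hU j
    V_le := fun j s => le_Gnj_genInv hn hU j
    V_jump := fun j s hs0 hs1 => (sqrt_mul_Gnj_genInv_sub_le hn hU hp hαj j hs0 hs1).trans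
      (mul_le_mul_of_nonneg_right hkM (by positivity))
    beta := fun j s hs0 hs1 => abs_betanj_le_of_biSup_le hn hU hp0 (by positivity) (hβ j) hs0 hs1 }

end GoodEvent

lemma bigOP.exists_forall_le {P : Measure Ω} {Z : Fin d → ℕ → Ω → ℝ} (h : ∀ j, bigOP P (Z j))
    {ε : ℝ} (hε : 0 < ε) :
    ∃ M, ∀ᶠ n in atTop, P {ω | ∃ j, M < |Z j n ω|} ≤ ENNReal.ofReal ε := by
  have hε' : 0 < ε / (d + 1) := by positivity
  choose M hM using fun j => h j _ hε'
  refine ⟨∑ j, |M j|, ?_⟩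
  filter_upwards [eventually_all.2 hM] with n hn
  calc P {ω | ∃ j, ∑ j, |M j| < |Z j n ω|} ≤ P (⋃ j, {ω | M j < |Z j n ω|}) := by
        refine measure_mono ?_
        rintro ω ⟨j, hj⟩
        refine mem_iUnion.2 ⟨j, lt_of_le_of_lt ?_ hj⟩
        exact (le_abs_self _).trans
          (Finset.single_le_sum (f := fun j => |M j|) (fun _ _ => abs_nonneg _) (Finset.mem_univ j))
    _ ≤ ∑ j, P {ω | M j < |Z j n ω|} := measure_iUnion_fintype_le _ _
    _ ≤ ∑ _j : Fin d, ENNReal.ofReal (ε / (d + 1)) := Finset.sum_le_sum fun j _ => hn j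
    _ = ENNReal.ofReal (d * (ε / (d + 1))) := by
        rw [Finset.sum_const, Finset.card_univ, Fintype.card_fin, nsmul_eq_mul,
          ENNReal.ofReal_mul (Nat.cast_nonneg d), ENNReal.ofReal_natCast]
    _ ≤ ENNReal.ofReal ε := by
        refine ENNReal.ofReal_le_ofReal ?_
        rw [mul_div_assoc', div_le_iff₀ (by positivity)]
        nlinarith

lemma oP1_of_forall_exists_le {P : Measure Ω} {Z : ℕ → Ω → ℝ}
    (h : ∀ η : ℝ, 0 < η → ∃ b : ℕ → ℝ, Tendsto b atTop (nhds 0) ∧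
      ∀ᶠ n in atTop, ∃ A : Set Ω, P A ≤ ENNReal.ofReal η ∧ ∀ ω, ω ∉ A → |Z n ω| ≤ b n) :
    oP1 P Z := by
  intro ε hε
  rw [ENNReal.tendsto_nhds_zero]
  intro η hη
  obtain ⟨r, hr0, hrη⟩ := ENNReal.lt_iff_exists_nnreal_btwn.1 hη
  obtain ⟨b, hb, hev⟩ := h r (by exact_mod_cast hr0)
  filter_upwards [hev, hb.eventually_lt_const hε] with n ⟨A, hA, hAb⟩ hbn
  refine (measure_mono fun ω hω => ?_).trans
    (hA.trans ((ENNReal.ofReal_coe_nnreal).trans_le hrη.le))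
  by_contra hωA
  have h1 : ε * 1 < |Z n ω| := hω
  linarith [hAb ω hωA]

lemma abs_biSup_le {ι : Type*} {S : Set ι} {f : ι → ℝ} {b : ℝ} (hb : 0 ≤ b)
    (h : ∀ s ∈ S, |f s| ≤ b) : abs (⨆ s ∈ S, |f s|) ≤ b := by
  rw [abs_of_nonneg (Real.iSup_nonneg fun s => Real.iSup_nonneg fun _ => abs_nonneg _)]
  exact Real.iSup_le (fun s => Real.iSup_le (h s) hb) hb

section Stochastic

variable {P : Measure Ω} [IsProbabilityMeasure P] {X : ℤ → Ω → Fin d → ℝ}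

/-- With probability close to one the deterministic bounds hold with a fixed constant. -/
lemma exists_eventually_sampleBounds (hmeas : ∀ i, Measurable (X i))
    (hstat : StrictlyStationary P X) (hcont : ∀ j, Continuous (margF P X j)) {θ₁ θ₂ θ₃ p lam : ℝ}
    (h41 : Condition41 P X θ₁) (h43 : Condition43 P X θ₂ θ₃) (hp0 : 0 < p) (hp : p < 1 / 2)
    (hpθ₁ : p < θ₁) (hpθ₂ : p < θ₂) (hlam : 1 / 2 + p ≤ lam) (hlamθ₃ : lam < θ₃)
    {η : ℝ} (hη : 0 < η) :
    ∃ M : ℝ, 1 ≤ M ∧ ∀ᶠ n : ℕ in atTop, 0 < n ∧ ∃ A : Set Ω, P A ≤ ENNReal.ofReal η ∧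
      ∀ ω, ω ∉ A → SampleBounds p M (√n) (n : ℝ)⁻¹ ((n : ℝ) ^ (-(1 / (2 * (1 - p)))))
        ((n : ℝ) ^ (-lam)) (cop P X) (fun u => Gn P X n u ω) (fun j s => Gnj P X n j s ω)
        (fun j s => genInv (fun x => Gnj P X n j x ω) s) := by
  have hη3 : 0 < η / 3 := by positivity
  have hlam0 : 0 < lam := by linarith
  obtain ⟨a, ha, hMn⟩ := exists_pos_eventually_le_of_forall_tendsto
    (f := fun n a => P {ω | 1 * 1 < |Mn P X n a p ω|})
    (fun δ hδ => h41 p ⟨hp0, hpθ₁⟩ δ hδ 1 one_pos) (ENNReal.ofReal_pos.2 hη3)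
  obtain ⟨Mα, hα⟩ := bigOP.exists_forall_le
    (fun j => (h43 p ⟨hp0, hpθ₂⟩ lam ⟨hlam0, hlamθ₃⟩ j).1) hη3
  obtain ⟨Mβ, hβ⟩ := bigOP.exists_forall_le
    (fun j => (h43 p ⟨hp0, hpθ₂⟩ lam ⟨hlam0, hlamθ₃⟩ j).2) hη3
  obtain ⟨k, hk⟩ := exists_nat_one_div_lt ha
  refine ⟨max ((k + 1 : ℕ) + 1) (max Mα Mβ), ?_, ?_⟩
  · refine le_max_of_le_left ?_
    have : (0 : ℝ) ≤ (k + 1 : ℕ) := Nat.cast_nonneg _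
    linarith
  have hℓ : ∀ᶠ n : ℕ in atTop, (n : ℝ) ^ (-lam) < 1 / 3 :=
    ((tendsto_rpow_neg_atTop hlam0).comp tendsto_natCast_atTop_atTop).eventually_lt_const
      (by norm_num)
  filter_upwards [hMn, hα, hβ, hℓ, eventually_gt_atTop 0] with n h1 h2 h3 h4 h5
  refine ⟨h5, _ ∪ (_ ∪ (_ ∪ {ω | ¬ InteriorSample P X n ω})), (measure_union_le _ _).trans
    ((add_le_add h1 ((measure_union_le _ _).trans (add_le_add h2
      ((measure_union_le _ _).trans (add_le_add h3
        (ae_iff.1 (ae_interiorSample hmeas hstat hcont n)).le))))).trans_eq ?_), ?_⟩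
  · rw [add_zero, ← ENNReal.ofReal_add hη3.le hη3.le, ← ENNReal.ofReal_add hη3.le (by positivity)]
    congr 1
    ring
  · intro ω hω
    simp only [mem_union, mem_ofPred_eq, not_or, not_lt, not_exists, not_not] at hω
    obtain ⟨hω1, hω2, hω3, hω4⟩ := hω
    refine sampleBounds_of_event (hmeas 0) hcont h5 hω4 hp0 hp hlam h4 (Nat.succ_pos k) ?_
      (le_max_left _ _) ((le_abs_self _).trans (hω1.trans_eq (one_mul 1))) ?_ ?_
    · push_cast
      exact hk.le
    · exact fun j => (le_abs_self _).trans
        ((hω2 j).trans ((le_max_left _ _).trans (le_max_right _ _)))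
    · exact fun j => (le_abs_self _).trans
        ((hω3 j).trans ((le_max_right _ _).trans (le_max_right _ _)))

lemma Cbar_eq_linearized (hX : Measurable (X 0)) (hcont : ∀ j, Continuous (margF P X j)) {n : ℕ}
    {u : Fin d → ℝ} (hu : inCube u) (ω : Ω) :
    Cbar P X n u ω = √n * (Gn P X n u ω - cop P X u) -
      ∑ j, Cdot (cop P X) j u * (√n * (Gnj P X n j (u j) ω - u j)) := by
  rw [Cbar, alphan]
  congr 1
  refine Finset.sum_congr rfl fun j _ => ?_
  rw [alphan_update_one hX hcont j (hu j).1 (hu j).2, alphanj]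

lemma gW_eq_gTilde (hd : 2 ≤ d) {w a : ℝ} (ha : 0 < a) {u : Fin d → ℝ}
    (hu : ∀ k, a ≤ u k ∧ u k ≤ 1 - a) : gW w u = gTilde w u :=
  (gTilde_of_g1_pos (ha.trans_le (le_g1 hd hu))).symm

/-- A vanishing bound, with probability close to one, for the moduli of continuity of both weighted
processes. -/
lemma exists_weighted_modulus_tendsto (hd : 2 ≤ d) (hmeas : ∀ i, Measurable (X i))
    (hstat : StrictlyStationary P X) (hcont : ∀ j, Continuous (margF P X j)) {θ₁ θ₂ θ₃ : ℝ}
    (hθ₁ : θ₁ ≤ 1 / 2) (hC : Condition21 (cop P X))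
    (h41 : Condition41 P X θ₁) (h43 : Condition43 P X θ₂ θ₃) {w c : ℝ} (hw : 0 < w)
    (hwθ₁ : w < θ₁) (hwθ₂ : w < θ₂) (hwθ₃ : w < θ₃ - 1 / 2) (hc0 : 0 < c) (hc1 : c < 1)
    {δ : ℕ → ℝ} (hδ : Tendsto δ atTop (nhds 0)) {η : ℝ} (hη : 0 < η) :
    ∃ b : ℕ → ℝ, Tendsto b atTop (nhds 0) ∧ ∀ᶠ n in atTop, 0 ≤ b n ∧
      ∃ A : Set Ω, P A ≤ ENNReal.ofReal η ∧ ∀ ω, ω ∉ A →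
      (∀ u u' : Fin d → ℝ, (∀ j, c / n ≤ u j ∧ u j ≤ 1 - c / n) →
        (∀ j, c / n ≤ u' j ∧ u' j ≤ 1 - c / n) → dist u u' ≤ δ n →
        |CPgi P X n u ω / gW w u - CPgi P X n u' ω / gW w u'| ≤ b n) ∧
      (∀ u u' : Fin d → ℝ, inCube u → inCube u' → dist u u' ≤ δ n →
        |Cbar P X n u ω / gTilde w u - Cbar P X n u' ω / gTilde w u'| ≤ b n) := by
  obtain ⟨p, hwp, hp⟩ := exists_between (lt_min hwθ₁ (lt_min hwθ₂ hwθ₃))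
  obtain ⟨hpθ₁, hp⟩ := lt_min_iff.1 hp
  obtain ⟨hpθ₂, hpθ₃⟩ := lt_min_iff.1 hp
  obtain ⟨lam, hlam, hlamθ₃⟩ := exists_between (by linarith : 1 / 2 + p < θ₃)
  have hp2 : p < 1 / 2 := by linarith
  have hp0 : 0 < p := hw.trans hwp
  obtain ⟨M, hM, hS⟩ := exists_eventually_sampleBounds hmeas hstat hcont h41 h43 hp0 hp2 hpθ₁
    hpθ₂ hlam.le hlamθ₃ hη
  obtain ⟨L, hL⟩ := exists_copulaBounds (hmeas 0) hcont hC
  obtain ⟨B, hB, hbound⟩ := exists_weighted_modulus_bound hd hM hL.one_le hc0 hc1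
  have hsqrt : Tendsto (fun n : ℕ => (√(n : ℝ))⁻¹) atTop (nhds 0) :=
    tendsto_inv_atTop_zero.comp (Real.tendsto_sqrt_atTop.comp tendsto_natCast_atTop_atTop)
  have hΔ : Tendsto (fun n : ℕ => max (δ n) (√(n : ℝ))⁻¹) atTop (nhds 0) := by
    simpa using hδ.max hsqrt
  refine ⟨_, tendsto_weighted_modulus (B := B) hw hwp (by linarith) hΔ, ?_⟩
  filter_upwards [hS, hΔ.eventually_le_const one_pos] with n ⟨hn, A, hA, hAS⟩ hΔ1
  have hn' : (0 : ℝ) < n := by positivity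
  have hΔ0 : 0 ≤ max (δ n) (√(n : ℝ))⁻¹ := le_max_of_le_right (by positivity)
  refine ⟨by positivity, A, hA, fun ω hω => ?_⟩
  have S := hAS ω hω
  have hτ : ((n : ℝ) ^ (-(1 / (2 * (1 - p))))) ^ (1 - p) ≤ max (δ n) (√(n : ℝ))⁻¹ :=
    (eq_inv_of_mul_eq_one_right S.rt_mul).le.trans (le_max_right _ _)
  have hmod := hbound _ _ _ _ _ _ _ _ _ _ S hL w _ hw hwp hτ hΔ1
  have hcn : 0 < c / n := div_pos hc0 hn'
  constructor
  · intro u u' hu hu' huv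
    have hcube : ∀ u : Fin d → ℝ, (∀ j, c / n ≤ u j ∧ u j ≤ 1 - c / n) → inCube u :=
      fun u hu j => ⟨hcn.le.trans (hu j).1, by linarith [(hu j).2]⟩
    rw [gW_eq_gTilde hd hcn hu, gW_eq_gTilde hd hcn hu']
    exact (hmod u u' (hcube u hu) (hcube u' hu') (huv.trans (le_max_left _ _))).2
      (by simpa only [div_eq_mul_inv] using hu) (by simpa only [div_eq_mul_inv] using hu')
  · intro u u' hu hu' huv
    rw [Cbar_eq_linearized (hmeas 0) hcont hu, Cbar_eq_linearized (hmeas 0) hcont hu']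
    exact (hmod u u' hu hu' (huv.trans (le_max_left _ _))).1

end Stochastic

lemma div_two_mul_one_sub_le {θ : ℝ} (h0 : 0 < θ) (h1 : θ ≤ 1 / 2) : θ / (2 * (1 - θ)) ≤ θ :=
  div_le_self h0.le (by linarith)

/-- Lemma 4.10: asymptotic uniform equicontinuity of the weighted processes
`𝔺_n/g_ω` (on `[c/n, 1-c/n]^d`) and `C̄_n/g̃_ω` (on `[0,1]^d`). -/
theorem weighted_asymptotic_equicontinuity
    {Ω : Type*} [MeasurableSpace Ω] {d : ℕ} (hd : 2 ≤ d)
    (P : Measure Ω) [IsProbabilityMeasure P] (X : ℤ → Ω → Fin d → ℝ)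
    (hmeas : ∀ i, Measurable (X i)) (hstat : StrictlyStationary P X)
    (hcont : ∀ j, Continuous (margF P X j))
    (θ₁ θ₂ θ₃ : ℝ) (hθ₁ : θ₁ ∈ Set.Ioc (0 : ℝ) (1/2)) (hθ₂ : θ₂ ∈ Set.Ioc (0 : ℝ) (1/2))
    (hθ₃ : θ₃ ∈ Set.Ioc (1/2 : ℝ) 1)
    (hC : Condition21 (cop P X)) (h41 : Condition41 P X θ₁) (h43 : Condition43 P X θ₂ θ₃) :
    ∀ w ∈ Set.Ioo (0 : ℝ) (min (θ₁ / (2 * (1 - θ₁))) (min (θ₂ / (2 * (1 - θ₂))) (θ₃ - 1/2))), ∀ c ∈ Set.Ioo (0 : ℝ) 1,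
      ∀ δ : ℕ → ℝ, Antitone δ → Tendsto δ atTop (nhds 0) →
        oP1 P (fun n ω =>
          ⨆ q ∈ {q : (Fin d → ℝ) × (Fin d → ℝ) |
              q.1 ∈ {u : Fin d → ℝ | ∀ j, c / n ≤ u j ∧ u j ≤ 1 - c / n} ∧
              q.2 ∈ {u : Fin d → ℝ | ∀ j, c / n ≤ u j ∧ u j ≤ 1 - c / n} ∧
              dist q.1 q.2 ≤ δ n},
            |CPgi P X n q.1 ω / gW w q.1 - CPgi P X n q.2 ω / gW w q.2|) ∧
        oP1 P (fun n ω =>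
          ⨆ q ∈ {q : (Fin d → ℝ) × (Fin d → ℝ) |
              q.1 ∈ Set.Icc 0 1 ∧ q.2 ∈ Set.Icc 0 1 ∧ dist q.1 q.2 ≤ δ n},
            |Cbar P X n q.1 ω / gTilde w q.1 - Cbar P X n q.2 ω / gTilde w q.2|) := by
  intro w ⟨hw, hwθ⟩ c ⟨hc0, hc1⟩ δ _ hδ
  obtain ⟨hwθ₁, hwθ⟩ := lt_min_iff.1 hwθ
  obtain ⟨hwθ₂, hwθ₃⟩ := lt_min_iff.1 hwθ
  have hbound := fun (η : ℝ) (hη : 0 < η) => exists_weighted_modulus_tendsto hd hmeas hstat hcont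
    hθ₁.2 hC h41 h43 hw (hwθ₁.trans_le (div_two_mul_one_sub_le hθ₁.1 hθ₁.2))
    (hwθ₂.trans_le (div_two_mul_one_sub_le hθ₂.1 hθ₂.2)) hwθ₃ hc0 hc1 hδ hη
  constructor <;> refine oP1_of_forall_exists_le fun η hη => ?_ <;>
    obtain ⟨b, hb, hev⟩ := hbound η hη <;> refine ⟨b, hb, hev.mono ?_⟩ <;>
    rintro n ⟨hbn, A, hA, hAb⟩ <;> refine ⟨A, hA, fun ω hω => abs_biSup_le hbn fun q hq => ?_⟩
  · exact (hAb ω hω).1 _ _ hq.1 hq.2.1 hq.2.2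
  · exact (hAb ω hω).2 _ _ (inCube_iff.2 hq.1) (inCube_iff.2 hq.2.1) hq.2.2

end BBV
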